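/- arXiv:1404.5722 — 3 statements merged into one kernel-verified Lean document; each statement's English description precedes it below -/
import Mathlib

section
/- Let m, n ≥ 1. Then h^n_m = 0 precisely in the following cases: (i) mn is odd; (ii) m = 1 or n = 1; (iii) m = 2 and n is odd, or n = 2 and m is odd; (iv) m = 3 and n ≡ 2 (mod 4), or n = 3 and m ≡ 2 (mod 4); (v) m = 5 and n ∈ {6, 10, 14}, or n = 5 and m ∈ {6, 10, 14}; (vi) m = 6 and n ∈ {7, 9, 11, 13}, or n = 6 and m ∈ {7, 9, 11, 13}; (vii) m = 7 and n = 10, or n = 7 and m = 10. -/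
set_option synthInstance.maxHeartbeats 1000000
noncomputable section

open MvPolynomial

/-- The binary form of degree `n` with coefficient vector `a`, as a polynomial in two
variables `X 0 = x`, `X 1 = y`. -/
def formPoly (n : ℕ) (a : Fin (n+1) → ℂ) : MvPolynomial (Fin 2) ℂ :=
  ∑ i : Fin (n+1), C (a i) * X 0 ^ (n - (i : ℕ)) * X 1 ^ (i : ℕ)

/-- The action of `SL(2,ℂ)` on coefficient vectors of binary forms of degree `n`,
given by linear substitution of the variables `x`, `y`. -/
def sl2Act (n : ℕ) (g : Matrix.SpecialLinearGroup (Fin 2) ℂ) (a : Fin (n+1) → ℂ) :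
    Fin (n+1) → ℂ := fun i =>
  coeff (Finsupp.single 0 (n - (i : ℕ)) + Finsupp.single 1 (i : ℕ))
    (bind₁ (fun j : Fin 2 => C (g.1 j 0) * X 0 + C (g.1 j 1) * X 1) (formPoly n a))

/-- The ring of invariants `I_n` of the binary form of degree `n`: the subalgebra of
`ℂ[a_0,…,a_n]` of polynomials invariant under the `SL(2,ℂ)`-action. -/
def invariantRing (n : ℕ) : Subalgebra ℂ (MvPolynomial (Fin (n+1)) ℂ) where
  carrier := {p | ∀ g : Matrix.SpecialLinearGroup (Fin 2) ℂ, ∀ a : Fin (n+1) → ℂ,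
    eval (sl2Act n g a) p = eval a p}
  mul_mem' := by
    intro p q hp hq g a
    simp only [Set.mem_setOf_eq, map_mul] at *
    rw [hp g a, hq g a]
  add_mem' := by
    intro p q hp hq g a
    simp only [Set.mem_setOf_eq, map_add] at *
    rw [hp g a, hq g a]
  algebraMap_mem' := by
    intro c g a
    simp

/-- `IsHSOP n d p` says that `p` is a homogeneous system of parameters of the invariant
ring of the binary form of degree `n`, with degree sequence `d` : the `p k` are
homogeneous of positive degrees `d k`, algebraically independent over `ℂ`, and `I_n` is a
finitely generated module over the subalgebra they generate. -/
def IsHSOP (n : ℕ) (d : Fin (n-2) → ℕ) (p : Fin (n-2) → invariantRing n) : Prop :=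
  (∀ k, 0 < d k) ∧
  (∀ k, ((p k : MvPolynomial (Fin (n+1)) ℂ)).IsHomogeneous (d k)) ∧
  AlgebraicIndependent ℂ p ∧
  Module.Finite (Algebra.adjoin ℂ (Set.range p)) (invariantRing n)

/-- The space of invariants of degree `m` of the binary form of degree `n`. -/
def invariantSpace (n m : ℕ) : Submodule ℂ (MvPolynomial (Fin (n+1)) ℂ) :=
  Subalgebra.toSubmodule (invariantRing n) ⊓ MvPolynomial.homogeneousSubmodule (Fin (n+1)) ℂ m

/-- `hdim n m = h^n_m`, the dimension over `ℂ` of the space of invariants of degree `m`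
of the binary form of degree `n`. -/
def hdim (n m : ℕ) : ℕ := Module.finrank ℂ (invariantSpace n m)

/-! ### Gaussian binomial coefficients -/

/-- The Gaussian binomial coefficient `[m + n choose m]_q`, as a polynomial in `q`. -/
def gaussPoly : ℕ → ℕ → Polynomial ℕ
  | 0, _ => 1
  | _ + 1, 0 => 1
  | m + 1, n + 1 => gaussPoly (m + 1) n + Polynomial.X ^ (n + 1) * gaussPoly m (n + 1)

namespace gaussPoly

theorem zero_left (n : ℕ) : gaussPoly 0 n = 1 := by rw [gaussPoly]

theorem zero_right (m : ℕ) : gaussPoly m 0 = 1 := by cases m <;> rw [gaussPoly]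

theorem succ_succ (m n : ℕ) : gaussPoly (m + 1) (n + 1) =
    gaussPoly (m + 1) n + Polynomial.X ^ (n + 1) * gaussPoly m (n + 1) := by rw [gaussPoly]

theorem succ_succ' (m n : ℕ) : gaussPoly (m + 1) (n + 1) =
    gaussPoly m (n + 1) + Polynomial.X ^ (m + 1) * gaussPoly (m + 1) n := by
  induction m generalizing n with
  | zero =>
    induction n with
    | zero => rw [succ_succ, zero_left, zero_right]
    | succ n ih =>
      conv_lhs => rw [succ_succ, ih]
      rw [succ_succ 0 n]
      simp only [zero_left]
      ring
  | succ m ihm =>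
    induction n with
    | zero =>
      conv_lhs => rw [succ_succ, ihm]
      rw [succ_succ m 0]
      simp only [zero_right]
      ring
    | succ n ihn =>
      conv_lhs => rw [succ_succ, ihn, ihm (n + 1)]
      rw [succ_succ (m + 1) n, succ_succ m (n + 1)]
      ring

theorem comm (m n : ℕ) : gaussPoly m n = gaussPoly n m := by
  induction m generalizing n with
  | zero => rw [zero_left, zero_right]
  | succ m ihm =>
    induction n with
    | zero => rw [zero_left, zero_right]
    | succ n ihn => rw [succ_succ, succ_succ', ihn, ihm]

theorem coeff_succ_succ (m n k : ℕ) : (gaussPoly (m + 1) (n + 1)).coeff k =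
    (gaussPoly (m + 1) n).coeff k +
      if n + 1 ≤ k then (gaussPoly m (n + 1)).coeff (k - (n + 1)) else 0 := by
  rw [succ_succ, Polynomial.coeff_add, Polynomial.coeff_X_pow_mul']

theorem coeff_succ_succ' (m n k : ℕ) : (gaussPoly (m + 1) (n + 1)).coeff k =
    (gaussPoly m (n + 1)).coeff k +
      if m + 1 ≤ k then (gaussPoly (m + 1) n).coeff (k - (m + 1)) else 0 := by
  rw [succ_succ', Polynomial.coeff_add, Polynomial.coeff_X_pow_mul']

theorem coeff_one_left (n k : ℕ) : (gaussPoly 1 n).coeff k = if k ≤ n then 1 else 0 := by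
  induction n generalizing k with
  | zero => simp [zero_right, Polynomial.coeff_one]
  | succ n ih =>
    rw [coeff_succ_succ, ih, zero_left, Polynomial.coeff_one]
    split_ifs <;> omega

theorem coeff_two_left (n k : ℕ) : (gaussPoly 2 n).coeff k =
    if k ≤ 2 * n then min k (2 * n - k) / 2 + 1 else 0 := by
  induction n generalizing k with
  | zero =>
    rw [zero_right, Polynomial.coeff_one]
    split_ifs <;> omega
  | succ n ih =>
    rw [coeff_succ_succ', ih, coeff_one_left]
    split_ifs <;> omega

theorem coeff_three_left_sub (n k : ℕ) (hk : k + 1 ≤ 2 * n + 2) :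
    ((gaussPoly 3 n).coeff (k + 1) : ℤ) - (gaussPoly 3 n).coeff k =
      ((k + 1) / 6 : ℕ) + (if (k + 1) % 6 = 1 then 0 else 1) -
        (if k + 1 ≤ n then 0 else (((k - n) / 2 + 1 : ℕ) : ℤ)) := by
  induction n generalizing k with
  | zero =>
    have : k = 0 ∨ k = 1 := by omega
    rcases this with rfl | rfl <;> simp [zero_right, Polynomial.coeff_one]
  | succ n ih =>
    simp only [coeff_succ_succ' 2, coeff_two_left]
    by_cases h : k < 3
    · have : k = 0 ∨ k = 1 ∨ k = 2 := by omega
      have h0 : (gaussPoly 3 n).coeff 0 = 1 := by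
        clear ih hk
        induction n with
        | zero => simp [zero_right]
        | succ n ih => rw [coeff_succ_succ, ih]; simp
      rcases this with rfl | rfl | rfl <;> simp [h0] <;> split_ifs <;> omega
    · have := ih (k - 3) (by omega)
      rw [show k - 3 + 1 = k + 1 - 3 by omega] at this
      simp only [Nat.reduceAdd, if_pos (show 3 ≤ k by omega),
        if_pos (show 3 ≤ k + 1 by omega)]
      generalize (gaussPoly 3 n).coeff (k + 1 - 3) = a at this ⊢
      generalize (gaussPoly 3 n).coeff (k - 3) = b at this ⊢
      clear ih
      split_ifs at this ⊢ <;> omega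

end gaussPoly

/-! ### Evaluating Gaussian binomial coefficients with lists -/

/-- Coefficientwise addition of lists. -/
def addList : List ℕ → List ℕ → List ℕ
  | [], b => b
  | a :: as, [] => a :: as
  | a :: as, b :: bs => (a + b) :: addList as bs

/-- The polynomial with a given list of coefficients. -/
def listPoly : List ℕ → Polynomial ℕ
  | [] => 0
  | a :: as => Polynomial.C a + Polynomial.X * listPoly as

theorem listPoly_addList (a b : List ℕ) :
    listPoly (addList a b) = listPoly a + listPoly b := by
  induction a generalizing b with
  | nil => simp [addList, listPoly]
  | cons x as ih =>
    cases b with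
    | nil => simp [addList, listPoly]
    | cons y bs => simp only [addList, listPoly, ih, map_add]; ring

theorem listPoly_replicate_append (N : ℕ) (a : List ℕ) :
    listPoly (List.replicate N 0 ++ a) = Polynomial.X ^ N * listPoly a := by
  induction N with
  | zero => simp
  | succ N ih => simp only [List.replicate_succ, List.cons_append, listPoly, ih, map_zero]; ring

theorem coeff_listPoly (a : List ℕ) (k : ℕ) : (listPoly a).coeff k = a.getD k 0 := by
  induction a generalizing k with
  | nil => simp [listPoly]
  | cons x as ih =>
    cases k with
    | zero => simp [listPoly]
    | succ k => simp [listPoly, ih]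

/-- Passes from the lists of `gaussPoly i n, gaussPoly (i + 1) n, …` to those of
`gaussPoly i (n + 1), …`, given `N = n + 1` and the list `prev` of `gaussPoly (i - 1) N`. -/
def gaussStep (N : ℕ) : List ℕ → List (List ℕ) → List (List ℕ)
  | _, [] => []
  | prev, p :: ps =>
    let q := addList p (List.replicate N 0 ++ prev)
    q :: gaussStep N q ps

/-- The coefficient lists of `gaussPoly i n` for `1 ≤ i ≤ M`. -/
def gaussRow (M : ℕ) : ℕ → List (List ℕ)
  | 0 => List.replicate M [1]
  | n + 1 => gaussStep (n + 1) [1] (gaussRow M n)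

theorem listPoly_gaussStep (n i : ℕ) (prev : List ℕ) (ps : List (List ℕ))
    (hprev : listPoly prev = gaussPoly i (n + 1))
    (hps : ∀ j < ps.length, listPoly (ps.getD j []) = gaussPoly (i + 1 + j) n) (j : ℕ)
    (hj : j < ps.length) :
    listPoly ((gaussStep (n + 1) prev ps).getD j []) = gaussPoly (i + 1 + j) (n + 1) := by
  induction ps generalizing i prev j with
  | nil => simp at hj
  | cons p ps ih =>
    have hq : listPoly (addList p (List.replicate (n + 1) 0 ++ prev)) =
        gaussPoly (i + 1) (n + 1) := by
      rw [listPoly_addList, listPoly_replicate_append, hprev, gaussPoly.succ_succ]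
      have := hps 0 (by simp)
      simp only [List.getD_cons_zero, add_zero] at this
      rw [this]
    cases j with
    | zero => simpa [gaussStep] using hq
    | succ j =>
      simp only [gaussStep, List.getD_cons_succ]
      rw [ih (i + 1) _ hq _ j (by simpa using hj)]
      · congr 1; ring
      · intro l hl
        have := hps (l + 1) (by simpa using hl)
        simp only [List.getD_cons_succ] at this
        rw [this]
        congr 1; ring

theorem length_gaussStep (N : ℕ) (prev : List ℕ) (ps : List (List ℕ)) :
    (gaussStep N prev ps).length = ps.length := by
  induction ps generalizing prev with
  | nil => rfl
  | cons p ps ih => simp [gaussStep, ih]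

theorem length_gaussRow (M n : ℕ) : (gaussRow M n).length = M := by
  induction n with
  | zero => simp [gaussRow]
  | succ n ih => rw [gaussRow, length_gaussStep, ih]

theorem listPoly_gaussRow (M n j : ℕ) (hj : j < M) :
    listPoly ((gaussRow M n).getD j []) = gaussPoly (j + 1) n := by
  induction n generalizing j with
  | zero => simp [gaussRow, hj, gaussPoly.zero_right, listPoly]
  | succ n ih =>
    rw [gaussRow, listPoly_gaussStep n 0, zero_add, add_comm]
    · simp [listPoly, gaussPoly.zero_left]
    · intro l hl
      rw [length_gaussRow] at hl
      rw [ih l hl, zero_add, add_comm]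
    · rwa [length_gaussRow]

/-- The coefficient of `q ^ k` in `[m + 1 + n choose n]_q`, evaluated with lists. -/
def gaussCoeff (m n k : ℕ) : ℕ := ((gaussRow (m + 1) n).getD m []).getD k 0

theorem coeff_gaussPoly_succ (m n k : ℕ) :
    (gaussPoly (m + 1) n).coeff k = gaussCoeff m n k := by
  rw [gaussCoeff, ← coeff_listPoly, listPoly_gaussRow _ _ _ m.lt_succ_self]

/-! ### Counting monomials of given degree and weight -/

/-- Exponent vectors of degree `m` and weight `k` in the variables `a_0, …, a_n`. -/
def boxSet (n m k : ℕ) : Set (Fin (n + 1) → ℕ) :=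
  {f | ∑ i, f i = m ∧ ∑ i : Fin (n + 1), (i : ℕ) * f i = k}

theorem mem_boxSet {n m k : ℕ} {f : Fin (n + 1) → ℕ} :
    f ∈ boxSet n m k ↔ ∑ i, f i = m ∧ ∑ i : Fin (n + 1), (i : ℕ) * f i = k := Iff.rfl

theorem finite_boxSet (n m k : ℕ) : (boxSet n m k).Finite := by
  refine (Set.finite_Iic fun _ => m).subset fun f hf i => ?_
  exact hf.1 ▸ Finset.single_le_sum (fun _ _ => Nat.zero_le _) (Finset.mem_univ i)

theorem boxSet_zero_right (n k : ℕ) : boxSet n 0 k = if k = 0 then {0} else ∅ := by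
  ext f
  rw [mem_boxSet, Finset.sum_eq_zero_iff]
  have hf : (∀ i ∈ Finset.univ, f i = 0) ↔ f = 0 := by simp [funext_iff]
  rw [hf]
  constructor
  · rintro ⟨rfl, h⟩
    simp at h
    simp [h]
  · split_ifs with h
    · rintro rfl
      simp [h]
    · simp

theorem boxSet_zero_left (m k : ℕ) : boxSet 0 m k = if k = 0 then {fun _ => m} else ∅ := by
  ext f
  rw [mem_boxSet]
  simp only [Nat.reduceAdd, Finset.univ_unique, Fin.default_eq_zero, Finset.sum_singleton,
    Fin.val_zero, zero_mul]
  split_ifs with h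
  · simp only [h, and_true, Set.mem_singleton_iff, funext_iff]
    exact ⟨fun hf i => by rw [Fin.fin_one_eq_zero i, hf], fun hf => hf 0⟩
  · simp [Ne.symm h]

theorem boxSet_succ_succ (n m k : ℕ) : boxSet (n + 1) (m + 1) k =
    (fun f : Fin (n + 1) → ℕ => (Fin.snoc f 0 : Fin (n + 2) → ℕ)) '' boxSet n (m + 1) k ∪
      if n + 1 ≤ k then
        (fun f => f + Pi.single (Fin.last (n + 1)) 1) '' boxSet (n + 1) m (k - (n + 1))
      else ∅ := by
  ext f
  constructor
  · rintro ⟨h₁, h₂⟩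
    rw [Fin.sum_univ_castSucc] at h₁ h₂
    simp only [Fin.val_castSucc, Fin.val_last] at h₂
    rcases Nat.eq_zero_or_pos (f (Fin.last (n + 1))) with h | h
    · left
      refine ⟨fun i => f i.castSucc, ⟨by simpa [h] using h₁, by simpa [h] using h₂⟩, ?_⟩
      ext i
      refine Fin.lastCases ?_ (fun i => ?_) i <;> simp [h]
    · right
      have hk : n + 1 ≤ k := by
        have := Nat.le_mul_of_pos_right (n + 1) h
        omega
      rw [if_pos hk]
      obtain ⟨c, hc⟩ := Nat.exists_eq_succ_of_ne_zero h.ne'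
      refine ⟨Fin.snoc (fun i => f i.castSucc) c, ⟨?_, ?_⟩, ?_⟩
      · rw [Fin.sum_univ_castSucc]
        simp only [Fin.snoc_castSucc, Fin.snoc_last]
        omega
      · rw [Fin.sum_univ_castSucc]
        simp only [Fin.snoc_castSucc, Fin.snoc_last, Fin.val_castSucc, Fin.val_last]
        rw [hc, Nat.succ_eq_add_one, mul_add] at h₂
        omega
      · ext i
        refine Fin.lastCases ?_ (fun i => ?_) i
        · simp [hc]
        · simp [(Fin.castSucc_lt_last i).ne]
  · rintro (⟨g, ⟨h₁, h₂⟩, rfl⟩ | h)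
    · refine ⟨?_, ?_⟩ <;> rw [Fin.sum_univ_castSucc] <;> simpa
    · split_ifs at h with hk
      · obtain ⟨g, ⟨h₁, h₂⟩, rfl⟩ := h
        refine ⟨?_, ?_⟩
        · simp [Finset.sum_add_distrib, h₁]
        · simp only [Pi.add_apply, mul_add, Finset.sum_add_distrib, h₂, Pi.single_apply, mul_ite,
            mul_one, mul_zero, Finset.sum_ite_eq', Finset.mem_univ, if_true, Fin.val_last]
          omega
      · exact h.elim

theorem ncard_boxSet (n m k : ℕ) : (boxSet n m k).ncard = (gaussPoly m n).coeff k := by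
  induction n generalizing m k with
  | zero =>
    rw [boxSet_zero_left, gaussPoly.zero_right, Polynomial.coeff_one]
    split_ifs <;> simp
  | succ n ihn =>
    induction m generalizing k with
    | zero =>
      rw [boxSet_zero_right, gaussPoly.zero_left, Polynomial.coeff_one]
      split_ifs <;> simp
    | succ m ihm =>
      have hinj : Function.Injective
          (fun f : Fin (n + 1) → ℕ => (Fin.snoc f 0 : Fin (n + 2) → ℕ)) := fun f g h => by
        ext i
        simpa using congrFun h i.castSucc
      rw [boxSet_succ_succ, gaussPoly.coeff_succ_succ, Set.ncard_union_eq _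
        ((finite_boxSet _ _ _).image _) (by
          split_ifs
          · exact (finite_boxSet _ _ _).image _
          · exact Set.finite_empty)]
      · rw [Set.ncard_image_of_injective _ hinj, ihn]
        split_ifs
        · rw [Set.ncard_image_of_injective _ (add_left_injective _), ihm]
        · simp
      · rw [Set.disjoint_left]
        rintro _ ⟨f, -, rfl⟩ h
        split_ifs at h
        · obtain ⟨g, -, hg⟩ := h
          simpa using congrFun hg (Fin.last _)
        · exact h

/-! ### The infinitesimal action of `sl₂` -/

/-- If `(A B - B A) B^j u = -(2 + 2 j) B^j u` and `A B u = -2 u`, with `B` nilpotent on `u`,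
then `u = 0`. -/
theorem eq_zero_of_lowering {V : Type*} [AddCommGroup V] [Module ℂ V] (A B : V →ₗ[ℂ] V) (u : V)
    (hcomm : ∀ j : ℕ, A (B ((B ^ j) u)) - B (A ((B ^ j) u)) = (-(2 + 2 * j : ℂ)) • (B ^ j) u)
    (h0 : A (B u) = (-2 : ℂ) • u) (hnil : ∃ N, (B ^ N) u = 0) : u = 0 := by
  have key : ∀ j : ℕ, A ((B ^ (j + 1)) u) = (-((j + 1) * (j + 2) : ℂ)) • (B ^ j) u := by
    intro j
    induction j with
    | zero => simpa using h0
    | succ j ih =>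
      have h := hcomm (j + 1)
      rw [ih, map_smul, ← Module.End.mul_apply B, ← pow_succ', ← Module.End.mul_apply B,
        ← pow_succ', sub_eq_iff_eq_add, ← add_smul] at h
      rw [h]
      congr 1
      push_cast
      ring
  obtain ⟨N, hN⟩ := hnil
  induction N with
  | zero => simpa using hN
  | succ N ih =>
    refine ih ?_
    have h := key N
    rw [hN, map_zero] at h
    refine (smul_eq_zero.1 h.symm).resolve_left ?_
    refine neg_ne_zero.2 ?_
    exact_mod_cast Nat.mul_ne_zero (N.succ_ne_zero) (N + 1).succ_ne_zero

/-- The raising operator `∑ (j + 1) a_{j+1} ∂/∂a_j`. -/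
def raiseDer (n : ℕ) :
    Derivation ℂ (MvPolynomial (Fin (n + 1)) ℂ) (MvPolynomial (Fin (n + 1)) ℂ) :=
  mkDerivation ℂ fun j => if h : (j : ℕ) + 1 < n + 1 then
    C ((j : ℂ) + 1) * X ⟨j + 1, h⟩ else 0

/-- The lowering operator `∑ (n - j + 1) a_{j-1} ∂/∂a_j`. -/
def lowerDer (n : ℕ) :
    Derivation ℂ (MvPolynomial (Fin (n + 1)) ℂ) (MvPolynomial (Fin (n + 1)) ℂ) :=
  mkDerivation ℂ fun j => if (j : ℕ) = 0 then 0 else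
    C ((n : ℂ) - j + 1) * X ⟨j - 1, (Nat.sub_le _ _).trans_lt j.2⟩

/-- The weight operator `∑ (2 j - n) a_j ∂/∂a_j`. -/
def weightDer (n : ℕ) :
    Derivation ℂ (MvPolynomial (Fin (n + 1)) ℂ) (MvPolynomial (Fin (n + 1)) ℂ) :=
  mkDerivation ℂ fun j => C ((j : ℂ) + j - n) * X j

theorem lie_raiseDer_lowerDer (n : ℕ) : ⁅raiseDer n, lowerDer n⁆ = weightDer n := by
  ext1 j
  rw [Derivation.commutator_apply]
  simp only [raiseDer, lowerDer, weightDer, mkDerivation_X]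
  have hj := j.2
  have e1 : ∀ h : (j : ℕ) + 1 < n + 1, (⟨(⟨j + 1, h⟩ : Fin (n + 1)) - 1,
      (Nat.sub_le _ _).trans_lt h⟩ : Fin (n + 1)) = j := fun h => by ext; simp
  have e2 : ∀ (_ : (j : ℕ) ≠ 0) (h : (j : ℕ) - 1 + 1 < n + 1),
      (⟨(j : ℕ) - 1 + 1, h⟩ : Fin (n + 1)) = j := fun h0 h => by ext; simp; omega
  by_cases h0 : (j : ℕ) = 0
  · by_cases h1 : (j : ℕ) + 1 < n + 1
    · rw [if_pos h0, dif_pos h1]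
      simp only [map_zero, Derivation.leibniz, derivation_C, mkDerivation_X,
        smul_eq_mul]
      rw [if_neg (by simp), e1 h1]
      simp [h0]
    · have : n = 0 := by omega
      subst this
      simp
  · have h2 : (j : ℕ) - 1 + 1 < n + 1 := by omega
    have hc : (((j : ℕ) - 1 : ℕ) : ℂ) = (j : ℂ) - 1 := by
      rw [Nat.cast_sub (by omega)]; simp
    rw [if_neg h0]
    simp only [Derivation.leibniz, derivation_C, mkDerivation_X,
        smul_eq_mul, dif_pos h2, e2 h0, hc]
    by_cases h1 : (j : ℕ) + 1 < n + 1
    · rw [dif_pos h1]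
      simp only [Derivation.leibniz, derivation_C, mkDerivation_X,
        smul_eq_mul]
      rw [if_neg (by simp), e1 h1]
      simp
      ring
    · have : (j : ℕ) = n := by omega
      rw [dif_neg h1]
      simp [this]

theorem raiseDer_lowerDer_sub (n : ℕ) (p : MvPolynomial (Fin (n + 1)) ℂ) :
    raiseDer n (lowerDer n p) - lowerDer n (raiseDer n p) = weightDer n p := by
  rw [← Derivation.commutator_apply, lie_raiseDer_lowerDer]

/-- The bidegree (degree, weight) of the variable `a_i`. -/
def biweight (n : ℕ) (i : Fin (n + 1)) : ℕ × ℕ := (1, i)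

theorem weight_biweight (n : ℕ) (s : Fin (n + 1) →₀ ℕ) :
    Finsupp.weight (biweight n) s = (∑ i, s i, ∑ i : Fin (n + 1), (i : ℕ) * s i) := by
  rw [Finsupp.weight_apply, Finsupp.sum_fintype _ _ (by simp)]
  ext
  · simp [biweight, Prod.fst_sum]
  · simp [biweight, Prod.snd_sum, mul_comm]

/-- Forms of degree `m` and weight `k`. -/
abbrev bihom (n m k : ℕ) : Submodule ℂ (MvPolynomial (Fin (n + 1)) ℂ) :=
  weightedHomogeneousSubmodule ℂ (biweight n) (m, k)

theorem mem_bihom_iff {n m k : ℕ} {p : MvPolynomial (Fin (n + 1)) ℂ} :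
    p ∈ bihom n m k ↔ ∀ s, coeff s p ≠ 0 → ∑ i, s i = m ∧ ∑ i : Fin (n + 1), (i : ℕ) * s i = k := by
  rw [mem_weightedHomogeneousSubmodule]
  simp only [IsWeightedHomogeneous, weight_biweight, Prod.mk.injEq]

theorem bihom_eq (n m k : ℕ) : bihom n m k =
    restrictSupport ℂ ((fun s : Fin (n + 1) →₀ ℕ => ⇑s) ⁻¹' boxSet n m k) := by
  ext p
  rw [mem_bihom_iff, mem_restrictSupport_iff]
  simp [Set.subset_def, mem_boxSet]

theorem finite_preimage_boxSet (n m k : ℕ) :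
    ((fun s : Fin (n + 1) →₀ ℕ => ⇑s) ⁻¹' boxSet n m k).Finite :=
  (finite_boxSet n m k).preimage DFunLike.coe_injective.injOn

instance (n m k : ℕ) : Module.Finite ℂ (bihom n m k) := by
  rw [bihom_eq]
  have := (finite_preimage_boxSet n m k).to_subtype
  exact Module.Finite.of_basis (basisRestrictSupport ℂ _)

theorem finrank_bihom (n m k : ℕ) :
    Module.finrank ℂ (bihom n m k) = (gaussPoly m n).coeff k := by
  rw [bihom_eq, Module.finrank_eq_nat_card_basis (basisRestrictSupport ℂ _), Nat.card_coe_set_eq,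
    ← ncard_boxSet, Set.ncard_preimage_of_injective_subset_range DFunLike.coe_injective]
  intro f _
  exact ⟨Finsupp.equivFunOnFinite.symm f, by simp⟩

theorem bihom_eq_bot {n m k : ℕ} (h : n * m < k) : bihom n m k = ⊥ := by
  rw [eq_bot_iff]
  intro p hp
  rw [Submodule.mem_bot]
  by_contra hne
  obtain ⟨s, hs⟩ := MvPolynomial.exists_coeff_ne_zero hne
  obtain ⟨h₁, h₂⟩ := mem_bihom_iff.1 hp s hs
  have : ∑ i : Fin (n + 1), (i : ℕ) * s i ≤ ∑ i, n * s i :=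
    Finset.sum_le_sum fun i _ => Nat.mul_le_mul_right _ (Nat.lt_succ_iff.1 i.2)
  rw [← Finset.mul_sum, h₁, h₂] at this
  omega

theorem derivation_mem_of_bihom {n m k : ℕ}
    (D : Derivation ℂ (MvPolynomial (Fin (n + 1)) ℂ) (MvPolynomial (Fin (n + 1)) ℂ))
    (N : Submodule ℂ (MvPolynomial (Fin (n + 1)) ℂ))
    (h : ∀ (a b : ℕ) (q : MvPolynomial (Fin (n + 1)) ℂ) (i : Fin (n + 1)),
      q ∈ bihom n a b → a + 1 = m → b + i = k → q * D (X i) ∈ N)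
    {p : MvPolynomial (Fin (n + 1)) ℂ} (hp : p ∈ bihom n m k) : D p ∈ N := by
  rw [p.as_sum, map_sum]
  refine Submodule.sum_mem _ fun s hs => ?_
  have hs' := hp (mem_support_iff.1 hs)
  have hD : D = mkDerivation ℂ fun i => D (X i) := by
    ext1 i
    rw [mkDerivation_X]
  rw [hD, mkDerivation_monomial]
  refine N.smul_mem _ (Submodule.sum_mem _ fun i hi => ?_)
  have hle : Finsupp.single i 1 ≤ s := by
    rw [Finsupp.single_le_iff]
    exact Nat.one_le_iff_ne_zero.2 (Finsupp.mem_support_iff.1 hi)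
  have hw : Finsupp.weight (biweight n) (s - Finsupp.single i 1) + (1, (i : ℕ)) = (m, k) := by
    rw [← hs']
    conv_rhs => rw [← tsub_add_cancel_of_le hle, map_add]
    simp [Finsupp.weight_single, biweight]
  rw [Prod.ext_iff] at hw
  exact h _ _ _ i (isWeightedHomogeneous_monomial _ _ _ rfl) hw.1 hw.2

theorem raiseDer_mem {n m k : ℕ} {p : MvPolynomial (Fin (n + 1)) ℂ} (hp : p ∈ bihom n m k) :
    raiseDer n p ∈ bihom n m (k + 1) := by
  refine derivation_mem_of_bihom _ _ (fun a b q i hq ha hb => ?_) hp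
  rw [raiseDer, mkDerivation_X]
  split_ifs with h
  · have := hq.mul ((isWeightedHomogeneous_C (biweight n) ((i : ℂ) + 1)).mul
      (isWeightedHomogeneous_X ℂ (biweight n) ⟨i + 1, h⟩))
    rw [mem_weightedHomogeneousSubmodule]
    convert this using 1
    ext <;> simp [biweight] <;> omega
  · simp

theorem lowerDer_mem {n m k : ℕ} {p : MvPolynomial (Fin (n + 1)) ℂ}
    (hp : p ∈ bihom n m (k + 1)) : lowerDer n p ∈ bihom n m k := by
  refine derivation_mem_of_bihom _ _ (fun a b q i hq ha hb => ?_) hp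
  rw [lowerDer, mkDerivation_X]
  split_ifs with h
  · simp
  · have := hq.mul ((isWeightedHomogeneous_C (biweight n) ((n : ℂ) - i + 1)).mul
      (isWeightedHomogeneous_X ℂ (biweight n) ⟨i - 1, (Nat.sub_le _ _).trans_lt i.2⟩))
    rw [mem_weightedHomogeneousSubmodule]
    convert this using 1
    ext <;> simp [biweight] <;> omega

theorem lowerDer_eq_zero {n m : ℕ} {p : MvPolynomial (Fin (n + 1)) ℂ}
    (hp : p ∈ bihom n m 0) : lowerDer n p = 0 := by
  rw [← Submodule.mem_bot ℂ]
  refine derivation_mem_of_bihom _ _ (fun a b q i hq ha hb => ?_) hp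
  rw [lowerDer, mkDerivation_X, if_pos (by omega)]
  simp

theorem coeff_weightDer (n : ℕ) (p : MvPolynomial (Fin (n + 1)) ℂ) (s : Fin (n + 1) →₀ ℕ) :
    coeff s (weightDer n p) =
      (2 * (∑ i : Fin (n + 1), (i : ℕ) * s i : ℕ) - n * (∑ i, s i : ℕ)) * coeff s p := by
  induction p using MvPolynomial.induction_on' with
  | add p q hp hq => rw [map_add, coeff_add, hp, hq, coeff_add, mul_add]
  | monomial t r =>
    have : weightDer n (monomial t r) =
        C (2 * (∑ i : Fin (n + 1), (i : ℕ) * t i : ℕ) - n * (∑ i, t i : ℕ) : ℂ) * monomial t r := by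
      rw [weightDer, mkDerivation_monomial, Finsupp.sum_fintype _ _ (by simp)]
      have h : ∀ i, monomial (t - Finsupp.single i 1) ((t i : ℕ) : ℂ) •
          (C (((i : ℕ) : ℂ) + (i : ℕ) - n) * X i : MvPolynomial (Fin (n + 1)) ℂ) =
          monomial t ((((i : ℕ) : ℂ) + (i : ℕ) - n) * t i) := by
        intro i
        rw [smul_eq_mul, mul_left_comm, X, monomial_mul, C_mul_monomial]
        by_cases hi : t i = 0
        · simp [hi]
        · rw [tsub_add_cancel_of_le, mul_one]
          rw [Finsupp.single_le_iff]
          omega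
      simp only [h]
      rw [← map_sum, smul_monomial, C_mul_monomial]
      congr 1
      rw [smul_eq_mul, mul_comm]
      congr 1
      push_cast
      rw [Finset.mul_sum, Finset.mul_sum, ← Finset.sum_sub_distrib]
      exact Finset.sum_congr rfl fun i _ => by ring
    rw [this, coeff_C_mul, coeff_monomial]
    split_ifs with h
    · rw [h]
    · simp

theorem weightDer_eq {n m k : ℕ} {p : MvPolynomial (Fin (n + 1)) ℂ} (hp : p ∈ bihom n m k) :
    weightDer n p = (2 * k - n * m : ℂ) • p := by
  ext s
  rw [coeff_weightDer, coeff_smul, smul_eq_mul]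
  by_cases hs : coeff s p = 0
  · simp [hs]
  · obtain ⟨h₁, h₂⟩ := mem_bihom_iff.1 hp s hs
    rw [h₁, h₂]

theorem pow_raiseDer_mem {n m k : ℕ} {p : MvPolynomial (Fin (n + 1)) ℂ} (hp : p ∈ bihom n m k)
    (j : ℕ) : ((raiseDer n).toLinearMap ^ j) p ∈ bihom n m (k + j) := by
  induction j with
  | zero => exact hp
  | succ j ih => rw [pow_succ', Module.End.mul_apply]; exact raiseDer_mem ih

theorem pow_lowerDer_mem {n m k : ℕ} {p : MvPolynomial (Fin (n + 1)) ℂ} (j : ℕ)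
    (hp : p ∈ bihom n m (k + j)) : ((lowerDer n).toLinearMap ^ j) p ∈ bihom n m k := by
  induction j generalizing k with
  | zero => exact hp
  | succ j ih =>
    rw [pow_succ', Module.End.mul_apply]
    exact lowerDer_mem (ih (by rwa [add_right_comm]))

theorem pow_lowerDer_eq_zero {n m k : ℕ} {p : MvPolynomial (Fin (n + 1)) ℂ}
    (hp : p ∈ bihom n m k) (j : ℕ) (hj : k < j) : ((lowerDer n).toLinearMap ^ j) p = 0 := by
  obtain ⟨i, rfl⟩ := Nat.exists_eq_add_of_lt hj
  rw [show k + i + 1 = i + (k + 1) by ring, pow_add, Module.End.mul_apply, pow_succ',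
    Module.End.mul_apply]
  have hp' : p ∈ bihom n m (0 + k) := by rwa [Nat.zero_add]
  rw [show (lowerDer n).toLinearMap (((lowerDer n).toLinearMap ^ k) p) = 0 from
    lowerDer_eq_zero (pow_lowerDer_mem k hp'), map_zero]

/-- A form of weight zero killed by the lowering operator is killed by the raising operator. -/
theorem raiseDer_eq_zero {n m k : ℕ} (hk : 2 * k = n * m) {p : MvPolynomial (Fin (n + 1)) ℂ}
    (hp : p ∈ bihom n m k) (h : lowerDer n p = 0) : raiseDer n p = 0 := by
  have hkc : (2 * k : ℂ) = n * m := by exact_mod_cast hk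
  refine eq_zero_of_lowering (lowerDer n).toLinearMap (raiseDer n).toLinearMap _ (fun j => ?_) ?_
    ⟨n * m + 1, ?_⟩
  · have hj := pow_raiseDer_mem (raiseDer_mem hp) j
    have := raiseDer_lowerDer_sub n (((raiseDer n).toLinearMap ^ j) (raiseDer n p))
    rw [weightDer_eq hj, ← neg_inj, neg_sub, ← neg_smul] at this
    refine this.trans ?_
    congr 1
    push_cast
    linear_combination -hkc
  · have := raiseDer_lowerDer_sub n (raiseDer n p)
    have h2 := raiseDer_lowerDer_sub n p
    rw [weightDer_eq hp, hkc, sub_self, zero_smul, h, map_zero, zero_sub, neg_eq_zero] at h2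
    rw [weightDer_eq (raiseDer_mem hp), h2, map_zero, zero_sub, neg_eq_iff_eq_neg, ← neg_smul]
      at this
    refine this.trans ?_
    congr 1
    push_cast
    linear_combination -hkc
  · have := pow_raiseDer_mem (raiseDer_mem hp) (n * m + 1)
    rwa [bihom_eq_bot (by omega), Submodule.mem_bot] at this

theorem eq_zero_of_lowerDer_raiseDer {n m k : ℕ} (hk : 2 * (k + 1) = n * m)
    {p : MvPolynomial (Fin (n + 1)) ℂ} (hp : p ∈ bihom n m k)
    (h : lowerDer n (raiseDer n p) = 0) : p = 0 := by
  have hkc : (2 * (k + 1) : ℂ) = n * m := by exact_mod_cast hk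
  refine eq_zero_of_lowering (raiseDer n).toLinearMap (lowerDer n).toLinearMap _ (fun j => ?_) ?_
    ⟨k + 1, pow_lowerDer_eq_zero hp _ k.lt_succ_self⟩
  · rcases le_or_gt j k with hjk | hjk
    · obtain ⟨i, rfl⟩ := Nat.exists_eq_add_of_le' hjk
      have hj := pow_lowerDer_mem j hp
      have := raiseDer_lowerDer_sub n (((lowerDer n).toLinearMap ^ j) p)
      rw [weightDer_eq hj] at this
      refine this.trans ?_
      congr 1
      push_cast at hkc ⊢
      linear_combination hkc
    · simp [pow_lowerDer_eq_zero hp j hjk]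
  · have := raiseDer_lowerDer_sub n p
    rw [weightDer_eq hp, h, sub_zero] at this
    refine this.trans ?_
    congr 1
    linear_combination hkc

/-- The lowering operator from weight `k + 1` to weight `k`. -/
def lowerMap (n m k : ℕ) : bihom n m (k + 1) →ₗ[ℂ] bihom n m k :=
  (lowerDer n).toLinearMap.restrict fun _ => lowerDer_mem

/-- The raising operator from weight `k` to weight `k + 1`. -/
def raiseMap (n m k : ℕ) : bihom n m k →ₗ[ℂ] bihom n m (k + 1) :=
  (raiseDer n).toLinearMap.restrict fun _ => raiseDer_mem

theorem surjective_lowerMap {n m k : ℕ} (hk : 2 * (k + 1) = n * m) :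
    Function.Surjective (lowerMap n m k) := by
  have hinj : Function.Injective (lowerMap n m k ∘ₗ raiseMap n m k) := by
    rw [injective_iff_map_eq_zero]
    rintro ⟨p, hp⟩ h
    have := congrArg Subtype.val h
    exact Subtype.ext (eq_zero_of_lowerDer_raiseDer hk hp this)
  have := LinearMap.injective_iff_surjective.1 hinj
  rw [LinearMap.coe_comp] at this
  exact this.of_comp

/-- The Cayley–Sylvester criterion for forms killed by the lowering operator. -/
theorem exists_lowerDer_eq_zero_iff {n m k : ℕ} (hk : 2 * (k + 1) = n * m) :
    (∃ p ∈ bihom n m (k + 1), p ≠ 0 ∧ lowerDer n p = 0) ↔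
      (gaussPoly m n).coeff k < (gaussPoly m n).coeff (k + 1) := by
  rw [← finrank_bihom, ← finrank_bihom]
  constructor
  · rintro ⟨p, hp, hne, h⟩
    by_contra hle
    have hle' := LinearMap.finrank_le_finrank_of_surjective (surjective_lowerMap hk)
    have hinj := (LinearMap.injective_iff_surjective_of_finrank_eq_finrank
      (le_antisymm (not_lt.1 hle) hle')).2 (surjective_lowerMap hk)
    refine hne (congrArg Subtype.val ((injective_iff_map_eq_zero _).1 hinj ⟨p, hp⟩ ?_))
    exact Subtype.ext h
  · intro hlt
    obtain ⟨⟨p, hp⟩, hker, hne⟩ := Submodule.exists_mem_ne_zero_of_ne_bot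
      (LinearMap.ker_ne_bot_of_finrank_lt (f := lowerMap n m k) hlt)
    exact ⟨p, hp, fun h => hne (Subtype.ext h), congrArg Subtype.val (LinearMap.mem_ker.1 hker)⟩

/-! ### The group action and the infinitesimal action -/

/-- The exponent of `x ^ (n - i) y ^ i`. -/
abbrev formExp (n i : ℕ) : Fin 2 →₀ ℕ := Finsupp.single 0 (n - i) + Finsupp.single 1 i

theorem formPoly_eq_sum (n : ℕ) (a : Fin (n + 1) → ℂ) :
    formPoly n a = ∑ i : Fin (n + 1), monomial (formExp n i) (a i) := by
  refine Finset.sum_congr rfl fun i _ => ?_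
  rw [X_pow_eq_monomial, X_pow_eq_monomial, C_mul_monomial, monomial_mul, mul_one, mul_one]

theorem formPoly_coeff {n : ℕ} {q : MvPolynomial (Fin 2) ℂ} (hq : q.IsHomogeneous n) :
    formPoly n (fun i => coeff (formExp n i) q) = q := by
  ext d
  rw [formPoly_eq_sum, coeff_sum]
  simp only [coeff_monomial]
  by_cases hd : d 0 + d 1 = n
  · rw [Finset.sum_eq_single ⟨d 1, by omega⟩]
    · have : formExp n (d 1) = d := by
        ext i
        fin_cases i <;> simp [formExp]
        omega
      simp [this]
    · intro i _ hi
      rw [if_neg]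
      rintro rfl
      exact hi (by ext; simp [formExp])
    · simp
  · rw [hq.coeff_eq_zero (by rwa [Finsupp.degree_eq_sum, Fin.sum_univ_two])]
    refine Finset.sum_eq_zero fun i _ => if_neg ?_
    rintro rfl
    refine hd ?_
    simp [formExp]
    omega

/-- The linear substitution of variables given by a matrix. -/
def linSubst (g : Matrix (Fin 2) (Fin 2) ℂ) (j : Fin 2) : MvPolynomial (Fin 2) ℂ :=
  C (g j 0) * X 0 + C (g j 1) * X 1

theorem isHomogeneous_linSubst (g : Matrix (Fin 2) (Fin 2) ℂ) (j : Fin 2) :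
    (linSubst g j).IsHomogeneous 1 := by
  have h : ∀ i : Fin 2, (C (g j i) * X i : MvPolynomial (Fin 2) ℂ).IsHomogeneous 1 := fun i => by
    simpa using (isHomogeneous_C (Fin 2) (g j i)).mul (isHomogeneous_X ℂ i)
  exact (h 0).add (h 1)

theorem bind₁_linSubst_formPoly (n : ℕ) (g : Matrix (Fin 2) (Fin 2) ℂ) (a : Fin (n + 1) → ℂ) :
    bind₁ (linSubst g) (formPoly n a) = ∑ i : Fin (n + 1),
      C (a i) * (linSubst g 0 ^ (n - (i : ℕ)) * linSubst g 1 ^ (i : ℕ)) := by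
  simp [formPoly, mul_assoc]

theorem isHomogeneous_bind₁_linSubst (n : ℕ) (g : Matrix (Fin 2) (Fin 2) ℂ)
    (a : Fin (n + 1) → ℂ) : (bind₁ (linSubst g) (formPoly n a)).IsHomogeneous n := by
  rw [bind₁_linSubst_formPoly]
  refine IsHomogeneous.sum _ _ _ fun i _ => ?_
  have := (isHomogeneous_C (Fin 2) (a i)).mul
    (((isHomogeneous_linSubst g 0).pow (n - i)).mul ((isHomogeneous_linSubst g 1).pow i))
  convert this using 1
  omega

theorem sl2Act_apply (n : ℕ) (g : Matrix.SpecialLinearGroup (Fin 2) ℂ) (a : Fin (n + 1) → ℂ)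
    (i : Fin (n + 1)) :
    sl2Act n g a i = coeff (formExp n i) (bind₁ (linSubst g.1) (formPoly n a)) := by
  have h : (bind₁ fun j : Fin 2 => (C (g.1 j 0) * X 0 + C (g.1 j 1) * X 1 : MvPolynomial ℕ ℂ)) =
      (rename Fin.val).comp (bind₁ (linSubst g.1)) := by
    ext1 j
    simp [linSubst]
  have he : Finsupp.single 0 (n - (i : ℕ)) + Finsupp.single 1 (i : ℕ) =
      (formExp n i).mapDomain Fin.val := by
    rw [Finsupp.mapDomain_add, Finsupp.mapDomain_single, Finsupp.mapDomain_single]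
    rfl
  rw [sl2Act, h, he, AlgHom.comp_apply, coeff_rename_mapDomain _ Fin.val_injective]

theorem formPoly_sl2Act (n : ℕ) (g : Matrix.SpecialLinearGroup (Fin 2) ℂ)
    (a : Fin (n + 1) → ℂ) :
    formPoly n (sl2Act n g a) = bind₁ (linSubst g.1) (formPoly n a) := by
  rw [← formPoly_coeff (isHomogeneous_bind₁_linSubst n g.1 a)]
  congr 1
  exact funext (sl2Act_apply n g a)

theorem sl2Act_mul (n : ℕ) (g h : Matrix.SpecialLinearGroup (Fin 2) ℂ) (a : Fin (n + 1) → ℂ) :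
    sl2Act n (g * h) a = sl2Act n h (sl2Act n g a) := by
  ext i
  rw [sl2Act_apply, sl2Act_apply, formPoly_sl2Act, bind₁_bind₁]
  congr 3
  ext1 j
  simp only [linSubst, Matrix.SpecialLinearGroup.coe_mul, Matrix.mul_apply, Fin.sum_univ_two,
    map_add, map_mul, bind₁_C_right, bind₁_X_right]
  ring

theorem sl2Act_one (n : ℕ) (a : Fin (n + 1) → ℂ) : sl2Act n 1 a = a := by
  ext i
  have : linSubst (1 : Matrix.SpecialLinearGroup (Fin 2) ℂ).1 = X := by
    ext1 j
    fin_cases j <;> simp [linSubst]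
  rw [sl2Act_apply, this, bind₁_X_left, AlgHom.id_apply, formPoly_eq_sum, coeff_sum,
    Finset.sum_eq_single i]
  · simp
  · intro j _ hj
    rw [coeff_monomial, if_neg]
    intro h
    have := DFunLike.congr_fun h 1
    exact hj (by ext; simpa [formExp] using this)
  · simp

/-- The substitution `y ↦ y + t x`. -/
def lowerUni (t : ℂ) : Matrix.SpecialLinearGroup (Fin 2) ℂ := ⟨!![1, 0; t, 1], by simp⟩

/-- The substitution `x ↦ x + t y`. -/
def upperUni (t : ℂ) : Matrix.SpecialLinearGroup (Fin 2) ℂ := ⟨!![1, t; 0, 1], by simp⟩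

theorem lowerUni_zero : lowerUni 0 = 1 := by
  ext i j
  fin_cases i <;> fin_cases j <;> simp [lowerUni]

theorem upperUni_zero : upperUni 0 = 1 := by
  ext i j
  fin_cases i <;> fin_cases j <;> simp [upperUni]

theorem sl2Act_lowerUni (n : ℕ) (t : ℂ) (a : Fin (n + 1) → ℂ) (j : Fin (n + 1)) :
    sl2Act n (lowerUni t) a j =
      ∑ i : Fin (n + 1), a i * ((i : ℕ).choose j * t ^ ((i : ℕ) - j)) := by
  rw [sl2Act_apply, bind₁_linSubst_formPoly, coeff_sum]
  refine Finset.sum_congr rfl fun i _ => ?_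
  rw [coeff_C_mul]
  congr 1
  have h : linSubst (lowerUni t).1 0 ^ (n - (i : ℕ)) * linSubst (lowerUni t).1 1 ^ (i : ℕ) =
      ∑ m ∈ Finset.range (i + 1),
        monomial (formExp n m) ((i : ℕ).choose m * t ^ ((i : ℕ) - m)) := by
    have h0 : linSubst (lowerUni t).1 0 = X 0 := by simp [linSubst, lowerUni]
    have h1 : linSubst (lowerUni t).1 1 = X 1 + C t * X 0 := by
      simp [linSubst, lowerUni, add_comm]
    rw [h0, h1, add_pow, Finset.mul_sum]
    refine Finset.sum_congr rfl fun m hm => ?_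
    have hm' : n - m = n - i + (i - m) := by
      have := i.2
      rw [Finset.mem_range] at hm
      omega
    rw [monomial_add_single, ← C_mul_X_pow_eq_monomial, hm']
    simp only [map_mul, map_pow, map_natCast]
    ring
  rw [h, coeff_sum]
  have hc : ∀ m, formExp n m = formExp n j ↔ m = j :=
    fun m => ⟨fun h => by simpa [formExp] using DFunLike.congr_fun h 1, fun h => by rw [h]⟩
  simp only [coeff_monomial, hc]
  rw [Finset.sum_ite_eq']
  simp only [Finset.mem_range]
  split_ifs with hj
  · rfl
  · rw [Nat.choose_eq_zero_of_lt (by omega)]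
    simp

theorem sl2Act_upperUni (n : ℕ) (t : ℂ) (a : Fin (n + 1) → ℂ) (j : Fin (n + 1)) :
    sl2Act n (upperUni t) a j =
      ∑ i : Fin (n + 1), a i * ((n - i : ℕ).choose (n - j) * t ^ ((j : ℕ) - i)) := by
  rw [sl2Act_apply, bind₁_linSubst_formPoly, coeff_sum]
  refine Finset.sum_congr rfl fun i _ => ?_
  rw [coeff_C_mul]
  congr 1
  have h : linSubst (upperUni t).1 0 ^ (n - (i : ℕ)) * linSubst (upperUni t).1 1 ^ (i : ℕ) =
      ∑ m ∈ Finset.range (n - i + 1),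
        monomial (formExp n (n - m)) ((n - i : ℕ).choose m * t ^ (n - i - m)) := by
    have h0 : linSubst (upperUni t).1 0 = X 0 + C t * X 1 := by simp [linSubst, upperUni]
    have h1 : linSubst (upperUni t).1 1 = X 1 := by simp [linSubst, upperUni]
    rw [h0, h1, add_pow, Finset.sum_mul]
    refine Finset.sum_congr rfl fun m hm => ?_
    have hi := i.2
    rw [Finset.mem_range] at hm
    have hm' : n - m = n - i - m + i := by omega
    rw [monomial_add_single, ← C_mul_X_pow_eq_monomial, Nat.sub_sub_self (by omega), hm']
    simp only [map_mul, map_pow, map_natCast]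
    ring
  rw [h, coeff_sum]
  have hc : ∀ m ∈ Finset.range (n - i + 1), formExp n (n - m) = formExp n j ↔ m = n - j :=
    fun m hm => by
      rw [Finset.mem_range] at hm
      have hj := j.2
      constructor
      · intro h
        have : n - m = j := by simpa [formExp] using DFunLike.congr_fun h 1
        omega
      · rintro rfl
        rw [Nat.sub_sub_self (by omega)]
  simp only [coeff_monomial]
  rw [Finset.sum_congr rfl fun m hm => by rw [if_congr (hc m hm) rfl rfl], Finset.sum_ite_eq']
  simp only [Finset.mem_range]
  have hj := j.2
  have hi := i.2
  split_ifs with h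
  · rw [show n - i - (n - j) = (j : ℕ) - i by omega]
  · rw [Nat.choose_eq_zero_of_lt (by omega)]
    simp

theorem hasDerivAt_eval {σ : Type*}
    (D : Derivation ℂ (MvPolynomial σ ℂ) (MvPolynomial σ ℂ)) (φ : ℂ → σ → ℂ) (t : ℂ)
    (h : ∀ j, HasDerivAt (fun s => φ s j) (eval (φ t) (D (X j))) t) (p : MvPolynomial σ ℂ) :
    HasDerivAt (fun s => eval (φ s) p) (eval (φ t) (D p)) t := by
  induction p using MvPolynomial.induction_on with
  | C a => simpa using hasDerivAt_const t a
  | add p q hp hq =>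
    simp only [map_add]
    exact hp.add hq
  | mul_X p i hp =>
    have := hp.mul (h i)
    simp only [map_mul, eval_X, Derivation.leibniz, map_add, smul_eq_mul]
    rw [add_comm, mul_comm _ (eval (φ t) (D p))]
    exact this

theorem hasDerivAt_sl2Act_lowerUni (n : ℕ) (a : Fin (n + 1) → ℂ) (t : ℂ) (j : Fin (n + 1)) :
    HasDerivAt (fun s => sl2Act n (lowerUni s) a j)
      (eval (sl2Act n (lowerUni t) a) (raiseDer n (X j))) t := by
  simp only [sl2Act_lowerUni]
  have h := HasDerivAt.fun_sum (u := Finset.univ) fun (i : Fin (n + 1)) _ =>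
    ((hasDerivAt_pow ((i : ℕ) - j) t).const_mul (((i : ℕ).choose j : ℕ) : ℂ)).const_mul (a i)
  refine h.congr_deriv ?_
  symm
  rw [raiseDer, mkDerivation_X]
  split_ifs with hj
  · simp only [map_mul, eval_C, eval_X, sl2Act_lowerUni, Finset.mul_sum]
    refine Finset.sum_congr rfl fun i _ => ?_
    have := congrArg (Nat.cast : ℕ → ℂ) (Nat.choose_succ_right_eq i j)
    push_cast at this
    rw [Nat.sub_sub, ← mul_assoc (((i : ℕ).choose j : ℕ) : ℂ), ← this]
    ring
  · rw [map_zero]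
    refine (Finset.sum_eq_zero fun i _ => ?_).symm
    rw [show (i : ℕ) - j = 0 by have := i.2; omega]
    simp

theorem hasDerivAt_sl2Act_upperUni (n : ℕ) (a : Fin (n + 1) → ℂ) (t : ℂ) (j : Fin (n + 1)) :
    HasDerivAt (fun s => sl2Act n (upperUni s) a j)
      (eval (sl2Act n (upperUni t) a) (lowerDer n (X j))) t := by
  simp only [sl2Act_upperUni]
  have h := HasDerivAt.fun_sum (u := Finset.univ) fun (i : Fin (n + 1)) _ =>
    ((hasDerivAt_pow ((j : ℕ) - i) t).const_mul (((n - i : ℕ).choose (n - j) : ℕ) : ℂ)).const_mul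
      (a i)
  refine h.congr_deriv ?_
  symm
  rw [lowerDer, mkDerivation_X]
  split_ifs with hj
  · rw [map_zero]
    refine (Finset.sum_eq_zero fun i _ => ?_).symm
    simp [hj]
  · have hjn := j.2
    simp only [map_mul, eval_C, eval_X, sl2Act_upperUni, Finset.mul_sum]
    refine Finset.sum_congr rfl fun i _ => ?_
    have hi := i.2
    have := congrArg (Nat.cast : ℕ → ℂ) (Nat.choose_succ_right_eq (n - i) (n - j))
    rw [show n - i - (n - j) = (j : ℕ) - i by omega,
      show n - j + 1 = n - (j - 1 : ℕ) by omega] at this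
    rw [show (j : ℕ) - i - 1 = j - 1 - i by omega,
      ← mul_assoc (((n - i : ℕ).choose (n - j) : ℕ) : ℂ), ← Nat.cast_mul, ← this,
      Nat.cast_mul, show n - (j - 1 : ℕ) = n - j + 1 by omega, Nat.cast_add,
      Nat.cast_sub (by omega)]
    push_cast
    ring

theorem sl2_generation {P : Matrix.SpecialLinearGroup (Fin 2) ℂ → Prop}
    (hmul : ∀ g h, P g → P h → P (g * h)) (hl : ∀ t, P (lowerUni t)) (hu : ∀ t, P (upperUni t))
    (g : Matrix.SpecialLinearGroup (Fin 2) ℂ) : P g := by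
  have main : ∀ g : Matrix.SpecialLinearGroup (Fin 2) ℂ, g.1 1 0 ≠ 0 → P g := by
    intro g hc
    have hdet : g.1 0 0 * g.1 1 1 - g.1 0 1 * g.1 1 0 = 1 := by
      rw [← Matrix.det_fin_two, g.2]
    have : g = upperUni ((g.1 0 0 - 1) / g.1 1 0) * lowerUni (g.1 1 0) *
        upperUni ((g.1 1 1 - 1) / g.1 1 0) := by
      apply Subtype.ext
      rw [Matrix.SpecialLinearGroup.coe_mul, Matrix.SpecialLinearGroup.coe_mul]
      ext i j
      fin_cases i <;> fin_cases j <;>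
        simp [upperUni, lowerUni, Matrix.mul_apply, Fin.sum_univ_two] <;> field_simp
      · ring
      · linear_combination -hdet
      · ring
    rw [this]
    exact hmul _ _ (hmul _ _ (hu _) (hl _)) (hu _)
  by_cases hc : g.1 1 0 = 0
  · have hdet : g.1 0 0 * g.1 1 1 - g.1 0 1 * g.1 1 0 = 1 := by
      rw [← Matrix.det_fin_two, g.2]
    have : g = g * lowerUni 1 * lowerUni (-1) := by
      rw [mul_assoc]
      have : lowerUni 1 * lowerUni (-1) = 1 := by
        apply Subtype.ext
        rw [Matrix.SpecialLinearGroup.coe_mul]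
        ext i j
        fin_cases i <;> fin_cases j <;> simp [lowerUni, Matrix.mul_apply, Fin.sum_univ_two]
      rw [this, mul_one]
    rw [this]
    refine hmul _ _ (main _ ?_) (hl _)
    have hd : (g * lowerUni 1).1 1 0 = g.1 1 1 := by
      rw [Matrix.SpecialLinearGroup.coe_mul]
      simp [lowerUni, Matrix.mul_apply, Fin.sum_univ_two, hc]
    rw [hd]
    intro h
    simp [hc, h] at hdet
  · exact main g hc

theorem mem_invariantRing {n : ℕ} {p : MvPolynomial (Fin (n + 1)) ℂ} : p ∈ invariantRing n ↔
    ∀ (g : Matrix.SpecialLinearGroup (Fin 2) ℂ) (a : Fin (n + 1) → ℂ),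
      eval (sl2Act n g a) p = eval a p := Iff.rfl

/-- Invariance under a one-parameter subgroup is the vanishing of its infinitesimal generator. -/
theorem invariant_iff_derivation_eq_zero {n : ℕ} {p : MvPolynomial (Fin (n + 1)) ℂ}
    (u : ℂ → Matrix.SpecialLinearGroup (Fin 2) ℂ) (hu : u 0 = 1)
    (D : Derivation ℂ (MvPolynomial (Fin (n + 1)) ℂ) (MvPolynomial (Fin (n + 1)) ℂ))
    (hD : ∀ a t j, HasDerivAt (fun s => sl2Act n (u s) a j)
      (eval (sl2Act n (u t) a) (D (X j))) t) :
    (∀ t a, eval (sl2Act n (u t) a) p = eval a p) ↔ D p = 0 := by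
  have key := fun a t => hasDerivAt_eval D (fun s => sl2Act n (u s) a) t (hD a t) p
  constructor
  · intro h
    refine MvPolynomial.funext fun a => ?_
    have h0 := key a 0
    simp only [h, hu, sl2Act_one] at h0
    rw [map_zero]
    exact h0.unique (hasDerivAt_const _ _)
  · intro h t a
    have := is_const_of_deriv_eq_zero (fun s => (key a s).differentiableAt)
      (fun s => by rw [(key a s).deriv, h, map_zero]) t 0
    simpa only [hu, sl2Act_one] using this

theorem mem_invariantRing_iff {n : ℕ} {p : MvPolynomial (Fin (n + 1)) ℂ} :
    p ∈ invariantRing n ↔ raiseDer n p = 0 ∧ lowerDer n p = 0 := by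
  rw [← invariant_iff_derivation_eq_zero lowerUni lowerUni_zero _ (hasDerivAt_sl2Act_lowerUni n),
    ← invariant_iff_derivation_eq_zero upperUni upperUni_zero _ (hasDerivAt_sl2Act_upperUni n),
    mem_invariantRing]
  refine ⟨fun h => ⟨fun t => h _, fun t => h _⟩, fun ⟨h₁, h₂⟩ => sl2_generation ?_ h₁ h₂⟩
  intro g h hg hh a
  rw [sl2Act_mul, hh, hg]

/-! ### The Cayley–Sylvester criterion -/

theorem two_mul_weight_of_mem_invariantSpace {n m : ℕ} {p : MvPolynomial (Fin (n + 1)) ℂ}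
    (hp : p ∈ invariantSpace n m) {s : Fin (n + 1) →₀ ℕ} (hs : coeff s p ≠ 0) :
    ∑ i, s i = m ∧ 2 * ∑ i : Fin (n + 1), (i : ℕ) * s i = n * m := by
  have hm : ∑ i, s i = m := by
    rw [← Finsupp.degree_eq_sum]
    by_contra hne
    exact hs (((mem_homogeneousSubmodule m p).1 hp.2).coeff_eq_zero hne)
  refine ⟨hm, ?_⟩
  obtain ⟨h₁, h₂⟩ := mem_invariantRing_iff.1 hp.1
  have h := raiseDer_lowerDer_sub n p
  rw [h₁, h₂, map_zero, map_zero, sub_zero] at h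
  have hc := coeff_weightDer n p s
  rw [← h, coeff_zero, hm, zero_eq_mul, or_iff_left hs, sub_eq_zero] at hc
  exact_mod_cast hc

theorem invariantSpace_eq_bot_of_odd {n m : ℕ} (h : Odd (m * n)) : invariantSpace n m = ⊥ := by
  rw [eq_bot_iff]
  intro p hp
  rw [Submodule.mem_bot]
  by_contra hne
  obtain ⟨s, hs⟩ := MvPolynomial.exists_coeff_ne_zero hne
  have := (two_mul_weight_of_mem_invariantSpace hp hs).2
  rw [mul_comm m, ← this] at h
  exact Nat.not_odd_iff_even.2 (even_two_mul _) h

theorem mem_invariantSpace_iff {n m k : ℕ} (hk : 2 * k = n * m)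
    {p : MvPolynomial (Fin (n + 1)) ℂ} :
    p ∈ invariantSpace n m ↔ p ∈ bihom n m k ∧ lowerDer n p = 0 := by
  constructor
  · intro hp
    refine ⟨mem_bihom_iff.2 fun s hs => ?_, (mem_invariantRing_iff.1 hp.1).2⟩
    have := two_mul_weight_of_mem_invariantSpace hp hs
    omega
  · rintro ⟨hp, h⟩
    refine ⟨mem_invariantRing_iff.2 ⟨raiseDer_eq_zero hk hp h, h⟩, ?_⟩
    refine (mem_homogeneousSubmodule m p).2 fun s hs => ?_
    rw [Finsupp.weight_apply, Finsupp.sum_fintype _ _ (by simp)]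
    simpa using (mem_bihom_iff.1 hp s hs).1

theorem hdim_ne_zero_iff_exists {n m : ℕ} :
    hdim n m ≠ 0 ↔ ∃ p ∈ invariantSpace n m, p ≠ 0 := by
  rcases Nat.even_or_odd (m * n) with h | h
  · obtain ⟨k, hk⟩ := h
    have hle : invariantSpace n m ≤ bihom n m k := fun p hp =>
      ((mem_invariantSpace_iff (by rw [mul_comm n, hk, two_mul])).1 hp).1
    have := Submodule.finiteDimensional_of_le hle
    rw [hdim, Ne, Submodule.finrank_eq_zero, ← Ne, Submodule.ne_bot_iff]
  · rw [hdim, invariantSpace_eq_bot_of_odd h]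
    simp

theorem hdim_ne_zero_iff {n m k : ℕ} (hk : 2 * (k + 1) = n * m) :
    hdim n m ≠ 0 ↔ (gaussPoly m n).coeff k < (gaussPoly m n).coeff (k + 1) := by
  rw [hdim_ne_zero_iff_exists, ← exists_lowerDer_eq_zero_iff hk]
  simp only [mem_invariantSpace_iff hk, and_assoc]
  exact exists_congr fun p => and_congr_right fun _ => and_comm

theorem hdim_eq_zero_of_odd {n m : ℕ} (h : Odd (m * n)) : hdim n m = 0 := by
  rw [hdim, invariantSpace_eq_bot_of_odd h]
  simp

/-- Nonvanishing of `hdim` is symmetric (a weak form of Hermite reciprocity). -/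
theorem hdim_ne_zero_comm {n m : ℕ} (hn : 1 ≤ n) (hm : 1 ≤ m) :
    hdim n m ≠ 0 ↔ hdim m n ≠ 0 := by
  rcases Nat.even_or_odd (m * n) with h | h
  · obtain ⟨k, hk⟩ := h
    have : 0 < m * n := Nat.mul_pos hm hn
    obtain ⟨k, rfl⟩ := Nat.exists_eq_succ_of_ne_zero (show k ≠ 0 by omega)
    rw [hdim_ne_zero_iff (k := k) (by rw [mul_comm n]; omega), hdim_ne_zero_iff (k := k) (by omega),
      gaussPoly.comm]
  · rw [hdim_eq_zero_of_odd h, hdim_eq_zero_of_odd (by rwa [mul_comm])]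

theorem hdim_add_ne_zero {n m m' : ℕ} (h : hdim n m ≠ 0) (h' : hdim n m' ≠ 0) :
    hdim n (m + m') ≠ 0 := by
  rw [hdim_ne_zero_iff_exists] at *
  obtain ⟨p, ⟨hp₁, hp₂⟩, hp⟩ := h
  obtain ⟨q, ⟨hq₁, hq₂⟩, hq⟩ := h'
  refine ⟨p * q, ⟨(invariantRing n).mul_mem hp₁ hq₁, ?_⟩, mul_ne_zero hp hq⟩
  exact (mem_homogeneousSubmodule _ _).2 (((mem_homogeneousSubmodule _ _).1 hp₂).mul
    ((mem_homogeneousSubmodule _ _).1 hq₂))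

/-! ### Vanishing and nonvanishing -/

theorem hdim_one_eq_zero {n : ℕ} (hn : 1 ≤ n) : hdim n 1 = 0 := by
  rcases Nat.even_or_odd n with ⟨t, ht⟩ | h
  · obtain ⟨k, rfl⟩ := Nat.exists_eq_succ_of_ne_zero (show t ≠ 0 by omega)
    by_contra h
    rw [← Ne, hdim_ne_zero_iff (k := k) (by omega), gaussPoly.coeff_one_left,
      gaussPoly.coeff_one_left] at h
    split_ifs at h <;> omega
  · exact hdim_eq_zero_of_odd (by rwa [one_mul])

theorem hdim_two_eq_zero {n : ℕ} (h : Odd n) : hdim n 2 = 0 := by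
  obtain ⟨t, rfl⟩ := h
  by_contra h
  rw [← Ne, hdim_ne_zero_iff (k := 2 * t) (by omega), gaussPoly.coeff_two_left,
    gaussPoly.coeff_two_left, if_pos (by omega), if_pos (by omega)] at h
  omega

theorem hdim_three_eq_zero {n : ℕ} (h : n % 4 = 2) : hdim n 3 = 0 := by
  obtain ⟨t, rfl⟩ : ∃ t, n = 4 * t + 2 := ⟨n / 4, by omega⟩
  by_contra h
  rw [← Ne, hdim_ne_zero_iff (k := 6 * t + 2) (by omega)] at h
  have := gaussPoly.coeff_three_left_sub (4 * t + 2) (6 * t + 2) (by omega)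
  rw [if_neg (by omega), if_neg (by omega)] at this
  omega

theorem hdim_three_ne_zero {n : ℕ} (hn : 1 ≤ n) (h : n % 4 = 0) : hdim n 3 ≠ 0 := by
  obtain ⟨t, rfl⟩ : ∃ t, n = 4 * t + 4 := ⟨n / 4 - 1, by omega⟩
  rw [hdim_ne_zero_iff (k := 6 * t + 5) (by omega)]
  have := gaussPoly.coeff_three_left_sub (4 * t + 4) (6 * t + 5) (by omega)
  rw [if_neg (by omega), if_neg (by omega)] at this
  omega

theorem hdim_two_ne_zero {n : ℕ} (hn : 1 ≤ n) (h : Even n) : hdim n 2 ≠ 0 := by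
  obtain ⟨t, rfl⟩ := h
  obtain ⟨k, rfl⟩ := Nat.exists_eq_succ_of_ne_zero (show t ≠ 0 by omega)
  rw [hdim_ne_zero_iff (k := 2 * k + 1) (by omega), gaussPoly.coeff_two_left,
    gaussPoly.coeff_two_left, if_pos (by omega), if_pos (by omega)]
  omega

theorem hdim_ne_zero_iff_gaussCoeff {n m k : ℕ} (hk : 2 * (k + 1) = n * (m + 1)) :
    hdim n (m + 1) ≠ 0 ↔
      gaussCoeff m n k < gaussCoeff m n (k + 1) := by
  rw [hdim_ne_zero_iff hk, coeff_gaussPoly_succ, coeff_gaussPoly_succ]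

theorem hdim_eq_zero_iff_gaussCoeff {n m k : ℕ} (hk : 2 * (k + 1) = n * (m + 1)) :
    hdim n (m + 1) = 0 ↔
      gaussCoeff m n (k + 1) ≤ gaussCoeff m n k := by
  rw [← not_lt, ← hdim_ne_zero_iff_gaussCoeff hk, not_not]

theorem hdim_eq_zero_comm {n m : ℕ} (hn : 1 ≤ n) (hm : 1 ≤ m) : hdim n m = 0 ↔ hdim m n = 0 :=
  not_iff_not.1 (hdim_ne_zero_comm hn hm)

theorem hdim_five_eq_zero {n : ℕ} (h : n = 6 ∨ n = 10 ∨ n = 14) : hdim n 5 = 0 := by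
  rcases h with rfl | rfl | rfl
  · exact (hdim_eq_zero_iff_gaussCoeff (k := 14) (by norm_num)).2 (by decide +kernel)
  · exact (hdim_eq_zero_iff_gaussCoeff (k := 24) (by norm_num)).2 (by decide +kernel)
  · exact (hdim_eq_zero_iff_gaussCoeff (k := 34) (by norm_num)).2 (by decide +kernel)

theorem hdim_six_eq_zero {n : ℕ} (h : n = 7 ∨ n = 9 ∨ n = 11 ∨ n = 13) : hdim n 6 = 0 := by
  rcases h with rfl | rfl | rfl | rfl
  · exact (hdim_eq_zero_iff_gaussCoeff (k := 20) (by norm_num)).2 (by decide +kernel)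
  · exact (hdim_eq_zero_iff_gaussCoeff (k := 26) (by norm_num)).2 (by decide +kernel)
  · exact (hdim_eq_zero_iff_gaussCoeff (k := 32) (by norm_num)).2 (by decide +kernel)
  · exact (hdim_eq_zero_iff_gaussCoeff (k := 38) (by norm_num)).2 (by decide +kernel)

theorem hdim_ten_seven : hdim 10 7 = 0 :=
  (hdim_eq_zero_iff_gaussCoeff (k := 34) (by norm_num)).2 (by decide +kernel)

theorem hdim_add_mul_ne_zero {n m m' : ℕ} (h : hdim n m ≠ 0) (hr : hdim n m' ≠ 0) (t : ℕ) :
    hdim n (m + t * m') ≠ 0 := by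
  induction t with
  | zero => simpa using h
  | succ t ih =>
    rw [add_mul, one_mul, ← add_assoc]
    exact hdim_add_ne_zero ih hr

/-- If the degrees `a` and `m'` occur, then so do all degrees `m ≥ a` with `m ≡ a (mod m')`. -/
theorem hdim_ne_zero_of_modEq {n m m' a : ℕ} (h : hdim n a ≠ 0) (h' : hdim n m' ≠ 0)
    (ham : a ≤ m) (hmod : m % m' = a % m') : hdim n m ≠ 0 := by
  obtain ⟨t, ht⟩ := (Nat.modEq_iff_dvd' ham).1 hmod.symm
  rw [show m = a + t * m' by rw [mul_comm, ← ht]; omega]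
  exact hdim_add_mul_ne_zero h h' t

theorem hdim_even_right_ne_zero {n m : ℕ} (hn : 1 ≤ n) (hm : 1 ≤ m) (h : Even n) (h' : Even m) :
    hdim n m ≠ 0 :=
  hdim_ne_zero_of_modEq (hdim_two_ne_zero hn h) (hdim_two_ne_zero hn h)
    (by obtain ⟨t, rfl⟩ := h'; omega) (by rw [Nat.even_iff.1 h'])

theorem hdim_four_left_ne_zero {m : ℕ} (hm : 2 ≤ m) : hdim 4 m ≠ 0 := by
  have h2 : hdim 4 2 ≠ 0 := hdim_two_ne_zero (by norm_num) (by decide)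
  rcases Nat.even_or_odd m with h | h
  · exact hdim_even_right_ne_zero (by norm_num) (by omega) (by decide) h
  · exact hdim_ne_zero_of_modEq (hdim_three_ne_zero (by norm_num) rfl) h2
      (by obtain ⟨t, rfl⟩ := h; omega) (by rw [Nat.odd_iff.1 h])

theorem hdim_four_ne_zero {n : ℕ} (hn : 2 ≤ n) : hdim n 4 ≠ 0 :=
  (hdim_ne_zero_comm (by norm_num) (by omega)).1 (hdim_four_left_ne_zero hn)

theorem hdim_dvd_four_ne_zero {n m : ℕ} (hn : 2 ≤ n) (hm : 1 ≤ m) (h : m % 4 = 0) :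
    hdim n m ≠ 0 :=
  hdim_ne_zero_of_modEq (hdim_four_ne_zero hn) (hdim_four_ne_zero hn) (by omega) (by omega)

theorem hdim_five_left_ne_zero {m : ℕ} (hm : 18 ≤ m) (h : m % 4 = 2) : hdim 5 m ≠ 0 := by
  refine hdim_ne_zero_of_modEq (a := 18) ?_ (hdim_four_ne_zero (by norm_num)) hm h
  rw [hdim_ne_zero_comm (by norm_num) (by norm_num)]
  exact (hdim_ne_zero_iff_gaussCoeff (k := 44) (by norm_num)).2 (by decide +kernel)

theorem hdim_seven_left_ne_zero {m : ℕ} (hm : 14 ≤ m) (h : m % 4 = 2) : hdim 7 m ≠ 0 := by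
  refine hdim_ne_zero_of_modEq (a := 14) ?_ (hdim_four_ne_zero (by norm_num)) hm h
  rw [hdim_ne_zero_comm (by norm_num) (by norm_num)]
  exact (hdim_ne_zero_iff_gaussCoeff (k := 48) (by norm_num)).2 (by decide +kernel)

/-- For even `m`, a lower bound on the odd `n` with `hdim n m ≠ 0` is propagated upwards. -/
theorem hdim_ne_zero_of_odd {n m a : ℕ} (hm : 1 ≤ m) (hme : Even m) (ha : 1 ≤ a) (hao : Odd a)
    (h : hdim a m ≠ 0) (han : a ≤ n) (hn : Odd n) : hdim n m ≠ 0 := by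
  rw [hdim_ne_zero_comm (by omega) hm]
  exact hdim_ne_zero_of_modEq ((hdim_ne_zero_comm ha hm).1 h) (hdim_two_ne_zero hm hme) han
    (by rw [Nat.odd_iff.1 hn, Nat.odd_iff.1 hao])

/-- Even degree `m ≡ 2 (mod 4)` and odd order `n`: the nonvanishing cases. -/
theorem hdim_ne_zero_of_mod_four_eq_two {n m : ℕ} (hm : m % 4 = 2) (hn : Odd n)
    (h : m = 6 ∧ 15 ≤ n ∨ m = 10 ∧ 9 ≤ n ∨ m = 14 ∧ 7 ≤ n ∨ 18 ≤ m ∧ 5 ≤ n) :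
    hdim n m ≠ 0 := by
  have he : Even m := Nat.even_iff.2 (by omega)
  have key : ∀ a, 1 ≤ a → Odd a → a ≤ n → hdim a m ≠ 0 → hdim n m ≠ 0 := fun a h1 h2 h3 h4 =>
    hdim_ne_zero_of_odd (by omega) he h1 h2 h4 h3 hn
  rcases h with ⟨rfl, h⟩ | ⟨rfl, h⟩ | ⟨rfl, h⟩ | ⟨hle, h⟩
  · exact key 15 (by norm_num) (by decide) h
      ((hdim_ne_zero_iff_gaussCoeff (k := 44) (by norm_num)).2 (by decide +kernel))
  · exact key 9 (by norm_num) (by decide) h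
      ((hdim_ne_zero_iff_gaussCoeff (k := 44) (by norm_num)).2 (by decide +kernel))
  · exact key 7 (by norm_num) (by decide) h (hdim_seven_left_ne_zero le_rfl rfl)
  · exact key 5 (by norm_num) (by decide) h (hdim_five_left_ne_zero hle hm)

/-- The vanishing pattern for even degree and odd order. -/
theorem hdim_eq_zero_iff_of_even_of_odd {n m : ℕ} (hm : 1 ≤ m) (hme : Even m) (hn : Odd n) :
    hdim n m = 0 ↔ n = 1 ∨ m = 2 ∨ (n = 3 ∧ m % 4 = 2) ∨
      (n = 5 ∧ (m = 6 ∨ m = 10 ∨ m = 14)) ∨ (m = 6 ∧ (n = 7 ∨ n = 9 ∨ n = 11 ∨ n = 13)) ∨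
      (n = 7 ∧ m = 10) := by
  have hn1 : 1 ≤ n := hn.pos
  have hn' := Nat.odd_iff.1 hn
  have hm' := Nat.even_iff.1 hme
  constructor
  · intro h
    by_contra hcon
    rcases (by omega : m % 4 = 0 ∨ m % 4 = 2) with h4 | h4
    · exact hdim_dvd_four_ne_zero (by omega) hm h4 h
    · exact hdim_ne_zero_of_mod_four_eq_two h4 hn (by omega) h
  · rintro (rfl | rfl | ⟨rfl, h⟩ | ⟨rfl, h⟩ | ⟨rfl, h⟩ | ⟨rfl, rfl⟩)
    · exact (hdim_eq_zero_comm le_rfl hm).2 (hdim_one_eq_zero hm)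
    · exact hdim_two_eq_zero hn
    · exact (hdim_eq_zero_comm hn1 hm).2 (hdim_three_eq_zero h)
    · exact (hdim_eq_zero_comm hn1 hm).2 (hdim_five_eq_zero h)
    · exact hdim_six_eq_zero h
    · exact (hdim_eq_zero_comm hn1 hm).2 hdim_ten_seven

theorem stmt_8 (m n : ℕ) (hm : 1 ≤ m) (hn : 1 ≤ n) :
    hdim n m = 0 ↔
      (Odd (m * n) ∨
       (m = 1 ∨ n = 1) ∨
       ((m = 2 ∧ Odd n) ∨ (n = 2 ∧ Odd m)) ∨
       ((m = 3 ∧ n % 4 = 2) ∨ (n = 3 ∧ m % 4 = 2)) ∨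
       ((m = 5 ∧ (n = 6 ∨ n = 10 ∨ n = 14)) ∨ (n = 5 ∧ (m = 6 ∨ m = 10 ∨ m = 14))) ∨
       ((m = 6 ∧ (n = 7 ∨ n = 9 ∨ n = 11 ∨ n = 13)) ∨
        (n = 6 ∧ (m = 7 ∨ m = 9 ∨ m = 11 ∨ m = 13))) ∨
       ((m = 7 ∧ n = 10) ∨ (n = 7 ∧ m = 10))) := by
  rcases Nat.even_or_odd m with hme | hmo <;> rcases Nat.even_or_odd n with hne | hno
  · have h := hdim_even_right_ne_zero hn hm hne hme
    have hodd : ¬Odd (m * n) := Nat.not_odd_iff_even.2 (hme.mul_right n)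
    have hm' := Nat.not_odd_iff_even.2 hme
    have hn' := Nat.not_odd_iff_even.2 hne
    rw [Nat.even_iff] at hme hne
    refine iff_of_false h ?_
    simp only [hodd, hm', hn', and_false, false_or]
    rintro (h | h | h | h | h) <;> omega
  · have hodd : ¬Odd (m * n) := Nat.not_odd_iff_even.2 (hme.mul_right n)
    have hm' := Nat.not_odd_iff_even.2 hme
    rw [hdim_eq_zero_iff_of_even_of_odd hm hme hno]
    rw [Nat.even_iff] at hme
    simp only [hodd, hm', hno, and_false, and_true, or_false, false_or,
      show m ≠ 1 by omega, show m ≠ 3 by omega, show m ≠ 5 by omega, show m ≠ 7 by omega, false_and]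
    rw [Nat.odd_iff] at hno
    simp only [show n ≠ 6 by omega, false_and, or_false]
  · have hodd : ¬Odd (m * n) := Nat.not_odd_iff_even.2 (hne.mul_left m)
    have hn' := Nat.not_odd_iff_even.2 hne
    rw [hdim_eq_zero_comm hn hm, hdim_eq_zero_iff_of_even_of_odd hn hne hmo]
    rw [Nat.even_iff] at hne
    simp only [hodd, hn', hmo, and_false, and_true, or_false, false_or,
      show n ≠ 1 by omega, show n ≠ 3 by omega, show n ≠ 5 by omega, show n ≠ 7 by omega, false_and]
    rw [Nat.odd_iff] at hmo
    simp only [show m ≠ 6 by omega, false_and, false_or]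
  · exact iff_of_true (hdim_eq_zero_of_odd (hmo.mul hno)) (Or.inl (hmo.mul hno))
end
end

section
/- Let n ≥ 3 and set r = n − 2. If there exist hsops of I_n with degree sequences (d_1,…,d_{r−1}, d′) and (d_1,…,d_{r−1}, d″), then there also exists a hsop of I_n with degree sequence (d_1,…,d_{r−1}, d′ + d″). -/
set_option synthInstance.maxHeartbeats 1000000
noncomputable section

open MvPolynomial

section GradedAlgebra

variable {K A ι : Type*} [Field K] [CommRing A] [Algebra K A] [Fintype ι]
  (𝒜 : ℕ → Submodule K A) [GradedAlgebra 𝒜]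

omit [Fintype ι] in
theorem isHomogeneous_span_range {d : ι → ℕ} {p : ι → A} (hp : ∀ i, p i ∈ 𝒜 (d i)) :
    (Ideal.span (Set.range p)).IsHomogeneous 𝒜 :=
  Ideal.homogeneous_span 𝒜 _ (by rintro _ ⟨i, rfl⟩; exact ⟨d i, hp i⟩)

/-- A homogeneous element of the ideal generated by homogeneous elements is a combination of the
generators with homogeneous coefficients. -/
theorem exists_homogeneous_coeffs {d : ι → ℕ} {p : ι → A} (hp : ∀ i, p i ∈ 𝒜 (d i))
    {m : ℕ} {a : A} (ha : a ∈ 𝒜 m) (h : a ∈ Ideal.span (Set.range p)) :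
    ∃ b : ι → A, (∀ i, b i ∈ 𝒜 (m - d i)) ∧ (∀ i, m < d i → b i = 0) ∧
      ∑ i, b i * p i = a := by
  classical
  obtain ⟨c, rfl⟩ := Ideal.mem_span_range_iff_exists_fun.1 h
  refine ⟨fun i => if d i ≤ m then GradedAlgebra.proj 𝒜 (m - d i) (c i) else 0, ?_, ?_, ?_⟩
  · intro i
    dsimp only
    split_ifs
    · exact SetLike.coe_mem _
    · exact zero_mem _
  · intro i hi
    simp [hi]
  · have : GradedAlgebra.proj 𝒜 m (∑ i, c i * p i) = ∑ i, c i * p i :=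
      DirectSum.decompose_of_mem_same 𝒜 ha
    rw [← this, map_sum]
    refine Finset.sum_congr rfl fun i _ => ?_
    dsimp only
    split_ifs with hi
    · exact (DirectSum.coe_decompose_mul_of_right_mem_of_le 𝒜 (hp i) hi).symm
    · rw [zero_mul]
      exact (DirectSum.coe_decompose_mul_of_right_mem_of_not_le 𝒜 (hp i) hi).symm

omit [Fintype ι] in
/-- If a graded algebra is finite over the subalgebra generated by homogeneous elements, then the
ideal generated by these elements contains all components of large degree. -/
theorem exists_le_span_of_finite {d : ι → ℕ} {p : ι → A} (hp : ∀ i, p i ∈ 𝒜 (d i))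
    (hfin : Module.Finite (Algebra.adjoin K (Set.range p)) A) :
    ∃ M, ∀ m ≥ M, ∀ a ∈ 𝒜 m, a ∈ Ideal.span (Set.range p) := by
  classical
  set J := Ideal.span (Set.range p)
  have hJ : J.IsHomogeneous 𝒜 := isHomogeneous_span_range 𝒜 hp
  obtain ⟨s, hs⟩ := hfin.fg_top
  have hscalar : ∀ c ∈ Algebra.adjoin K (Set.range p), ∃ k : K, c - algebraMap K A k ∈ J := by
    intro c hc
    induction hc using Algebra.adjoin_induction with
    | mem x hx => exact ⟨0, by simpa using Ideal.subset_span hx⟩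
    | algebraMap r => exact ⟨r, by simp⟩
    | add x y _ _ hx hy =>
      obtain ⟨k, hk⟩ := hx
      obtain ⟨l, hl⟩ := hy
      refine ⟨k + l, ?_⟩
      rw [map_add, add_sub_add_comm]
      exact J.add_mem hk hl
    | mul x y _ _ hx hy =>
      obtain ⟨k, hk⟩ := hx
      obtain ⟨l, hl⟩ := hy
      refine ⟨k * l, ?_⟩
      have : x * y - algebraMap K A (k * l) =
          y * (x - algebraMap K A k) + algebraMap K A k * (y - algebraMap K A l) := by
        rw [map_mul]; ring
      rw [this]
      exact J.add_mem (J.mul_mem_left _ hk) (J.mul_mem_left _ hl)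
  obtain ⟨M, hM⟩ : ∃ M, ∀ b ∈ s, ∀ m ≥ M, GradedAlgebra.proj 𝒜 m b = 0 := by
    refine ⟨(s.biUnion fun b => (DirectSum.decompose 𝒜 b).support).sup id + 1,
      fun b hb m hm => ?_⟩
    by_contra hne
    have hmem : m ∈ s.biUnion fun b => (DirectSum.decompose 𝒜 b).support := by
      refine Finset.mem_biUnion.2 ⟨b, hb, DFinsupp.mem_support_iff.2 fun h => hne ?_⟩
      rw [GradedAlgebra.proj_apply, h, ZeroMemClass.coe_zero]
    have := Finset.le_sup (f := id) hmem
    simp only [id] at this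
    omega
  refine ⟨M, fun m hm a ha => ?_⟩
  rw [← DirectSum.decompose_of_mem_same 𝒜 ha, ← GradedAlgebra.proj_apply]
  have hmem : a ∈ Submodule.span (Algebra.adjoin K (Set.range p)) (s : Set A) :=
    hs ▸ Submodule.mem_top
  clear ha
  induction hmem using Submodule.span_induction with
  | mem x hx => rw [hM x hx m hm]; exact J.zero_mem
  | zero => rw [map_zero]; exact J.zero_mem
  | add x y _ _ hx hy => rw [map_add]; exact J.add_mem hx hy
  | smul c x _ hx =>
    obtain ⟨k, hk⟩ := hscalar c c.2
    have : c • x = k • x + x * (c - algebraMap K A k) := by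
      rw [Algebra.smul_def k x, Subalgebra.smul_def, smul_eq_mul]; ring
    rw [this, map_add, map_smul, Algebra.smul_def]
    exact J.add_mem (J.mul_mem_left _ hx) (hJ m (J.mul_mem_left _ hk))

/-- Graded Nakayama: a graded algebra with finite-dimensional components is finite over the
subalgebra generated by homogeneous elements of positive degree, as soon as the ideal they generate
contains all components of large degree. -/
theorem finite_adjoin_of_le_span (hfg : ∀ m, (𝒜 m).FG) {d : ι → ℕ} (hd : ∀ i, 0 < d i)
    {p : ι → A} (hp : ∀ i, p i ∈ 𝒜 (d i)) {M : ℕ}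
    (hM : ∀ m ≥ M, ∀ a ∈ 𝒜 m, a ∈ Ideal.span (Set.range p)) :
    Module.Finite (Algebra.adjoin K (Set.range p)) A := by
  classical
  choose s hs using hfg
  set N := Submodule.span (Algebra.adjoin K (Set.range p))
    (((Finset.range M).biUnion s : Finset A) : Set A)
  have key : ∀ m, ∀ a ∈ 𝒜 m, a ∈ N := by
    intro m
    induction m using Nat.strong_induction_on with
    | _ m ih =>
      intro a ha
      by_cases hm : m < M
      · rw [← hs m] at ha
        have : Submodule.span K (s m : Set A) ≤ N.restrictScalars K :=
          Submodule.span_le.2 fun x hx => Submodule.subset_span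
            (Finset.mem_biUnion.2 ⟨m, Finset.mem_range.2 hm, hx⟩)
        exact this ha
      · obtain ⟨b, hb, hb0, rfl⟩ := exists_homogeneous_coeffs 𝒜 hp ha (hM m (by omega) a ha)
        refine N.sum_mem fun i _ => ?_
        by_cases hi : m < d i
        · rw [hb0 i hi, zero_mul]
          exact N.zero_mem
        · have hbN := ih (m - d i) (by have := hd i; omega) (b i) (hb i)
          have := N.smul_mem ⟨p i, Algebra.subset_adjoin ⟨i, rfl⟩⟩ hbN
          rwa [Subalgebra.smul_def, smul_eq_mul, mul_comm] at this
  refine ⟨⟨(Finset.range M).biUnion s, top_unique fun a _ => ?_⟩⟩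
  rw [← DirectSum.sum_support_decompose 𝒜 a]
  exact N.sum_mem fun m _ => key m _ (SetLike.coe_mem _)

/-- If the ideal generated by homogeneous `p` contains the component of degree `m`, then so does
the ideal generated by `p + t • q` for all but finitely many scalars `t`. -/
theorem finite_setOf_not_le_span {m : ℕ} (hfg : (𝒜 m).FG) {d : ι → ℕ} {p q : ι → A}
    (hp : ∀ i, p i ∈ 𝒜 (d i)) (hq : ∀ i, q i ∈ 𝒜 (d i))
    (h : ∀ a ∈ 𝒜 m, a ∈ Ideal.span (Set.range p)) :
    {t : K | ¬ ∀ a ∈ 𝒜 m, a ∈ Ideal.span (Set.range (p + t • q))}.Finite := by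
  have : Module.Finite K (𝒜 m) := Module.Finite.iff_fg.2 hfg
  let e := Module.finBasis K (𝒜 m)
  have hc : ∀ j, ∃ c : ι → A, ∑ i, c i * p i = e j := fun j =>
    Ideal.mem_span_range_iff_exists_fun.1 (h _ (e j).2)
  choose c hc using hc
  let s : 𝒜 m →ₗ[K] (ι → A) := e.constr K c
  let L : (ι → A) → (ι → A) →ₗ[K] A := fun r =>
    ∑ i, (LinearMap.mulRight K (r i)) ∘ₗ LinearMap.proj i
  have hL : ∀ r b, L r b = ∑ i, b i * r i := fun r b => by simp [L]
  have hs : ∀ w : 𝒜 m, ∑ i, s w i * p i = w := by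
    have : L p ∘ₗ s = (𝒜 m).subtype := e.ext fun j => by simp [s, hL, hc]
    intro w
    rw [← hL]
    exact LinearMap.congr_fun this w
  let B : Module.End K (𝒜 m) :=
    ((GradedAlgebra.proj 𝒜 m).codRestrict (𝒜 m) fun _ => SetLike.coe_mem _) ∘ₗ L q ∘ₗ s
  refine (B.finite_spectrum.preimage (f := fun t : K => -t⁻¹) ?_).subset ?_
  · exact (neg_injective.comp inv_injective).injOn
  · intro t ht
    by_contra hspec
    refine ht fun a ha => ?_
    have hpq : ∀ i, (p + t • q) i ∈ 𝒜 (d i) := fun i =>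
      add_mem (hp i) (Submodule.smul_mem _ _ (hq i))
    have hsurj : ∃ w : 𝒜 m, w + t • B w = ⟨a, ha⟩ := by
      rcases eq_or_ne t 0 with rfl | ht0
      · exact ⟨⟨a, ha⟩, by simp⟩
      · have hu : IsUnit (algebraMap K (Module.End K (𝒜 m)) (-t⁻¹) - B) := by
          simpa [spectrum.mem_iff] using hspec
        obtain ⟨w, hw⟩ := ((Module.End.isUnit_iff _).1 hu).2 (-t⁻¹ • ⟨a, ha⟩)
        refine ⟨w, ?_⟩
        have := congrArg (fun x => (-t) • x) hw
        simpa [Module.algebraMap_end_apply, smul_sub, smul_smul, ht0] using this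
    obtain ⟨w, hw⟩ := hsurj
    have ha' : a = GradedAlgebra.proj 𝒜 m (∑ i, s w i * (p + t • q) i) := by
      have h1 : ∑ i, s w i * (p + t • q) i = w + t • L q (s w) := by
        simp only [Pi.add_apply, Pi.smul_apply, mul_add, Finset.sum_add_distrib, hs, hL,
          Finset.smul_sum, mul_smul_comm]
      rw [h1, map_add, map_smul]
      have h2 := congrArg Subtype.val hw
      have h3 : GradedAlgebra.proj 𝒜 m w = w := DirectSum.decompose_of_mem_same 𝒜 w.2
      rw [h3]
      exact h2.symm
    rw [ha']
    exact isHomogeneous_span_range 𝒜 hpq m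
      (Ideal.mem_span_range_iff_exists_fun.2 ⟨s w, rfl⟩)

/-- If both `(p, u)` and `(p, v)` generate ideals that contain all components of large degree, then
so does `(p, u * v)`. -/
theorem le_span_mul_update [DecidableEq ι] {d : ι → ℕ} {k : ι} {d' : ℕ}
    {p : ι → A} {u v : A} (hu : ∀ i, Function.update p k u i ∈ 𝒜 (Function.update d k d' i))
    {M N : ℕ} (hM : ∀ m ≥ M, ∀ a ∈ 𝒜 m, a ∈ Ideal.span (Set.range (Function.update p k u)))
    (hN : ∀ m ≥ N, ∀ a ∈ 𝒜 m, a ∈ Ideal.span (Set.range (Function.update p k v))) :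
    ∀ m ≥ M + N + d', ∀ a ∈ 𝒜 m,
      a ∈ Ideal.span (Set.range (Function.update p k (u * v))) := by
  intro m hm a ha
  set J := Ideal.span (Set.range (Function.update p k (u * v)))
  have hJ : ∀ i, i ≠ k → p i ∈ J := fun i hi =>
    Ideal.subset_span ⟨i, Function.update_of_ne hi _ _⟩
  have huv : u * v ∈ J := Ideal.subset_span ⟨k, Function.update_self _ _ _⟩
  obtain ⟨b, hb, -, rfl⟩ := exists_homogeneous_coeffs 𝒜 hu ha (hM m (by omega) a ha)
  refine J.sum_mem fun i _ => ?_
  rcases eq_or_ne i k with rfl | hi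
  · have hbi := hb i
    rw [Function.update_self] at hbi ⊢
    obtain ⟨c, hc⟩ := Ideal.mem_span_range_iff_exists_fun.1 (hN (m - d') (by omega) _ hbi)
    rw [← hc, Finset.sum_mul]
    refine J.sum_mem fun j _ => ?_
    rcases eq_or_ne j i with rfl | hj
    · rw [Function.update_self, mul_assoc, mul_comm v]
      exact J.mul_mem_left _ huv
    · rw [Function.update_of_ne hj]
      exact J.mul_mem_right _ (J.mul_mem_left _ (hJ j hj))
  · rw [Function.update_of_ne hi]
    exact J.mul_mem_left _ (hJ i hi)

/-- Two homogeneous families whose degrees agree away from the index `k` can be given common members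
away from `k`, keeping the respective members at `k` and the degrees from which on the components
lie in the generated ideals. -/
theorem exists_common_le_span_update [Uncountable K] [DecidableEq ι] (hfg : ∀ m, (𝒜 m).FG)
    {d : ι → ℕ} {k : ι} {d' d'' : ℕ} {p q : ι → A}
    (hp : ∀ i, p i ∈ 𝒜 (Function.update d k d' i))
    (hq : ∀ i, q i ∈ 𝒜 (Function.update d k d'' i)) {M N : ℕ}
    (hM : ∀ m ≥ M, ∀ a ∈ 𝒜 m, a ∈ Ideal.span (Set.range p))
    (hN : ∀ m ≥ N, ∀ a ∈ 𝒜 m, a ∈ Ideal.span (Set.range q)) :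
    ∃ f : ι → A, (∀ i, i ≠ k → f i ∈ 𝒜 (d i)) ∧
      (∀ m ≥ M, ∀ a ∈ 𝒜 m, a ∈ Ideal.span (Set.range (Function.update f k (p k)))) ∧
      ∀ m ≥ N, ∀ a ∈ 𝒜 m, a ∈ Ideal.span (Set.range (Function.update f k (q k))) := by
  have hpd : ∀ i, i ≠ k → p i ∈ 𝒜 (d i) := fun i hi => by
    simpa [Function.update_of_ne hi] using hp i
  have hqd : ∀ i, i ≠ k → q i ∈ 𝒜 (d i) := fun i hi => by
    simpa [Function.update_of_ne hi] using hq i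
  have hp' : ∀ i, Function.update p k 0 i ∈ 𝒜 (Function.update d k d'' i) := fun i => by
    rcases eq_or_ne i k with rfl | hi
    · simp
    · simpa [Function.update_of_ne hi] using hpd i hi
  have hq' : ∀ i, Function.update q k 0 i ∈ 𝒜 (Function.update d k d' i) := fun i => by
    rcases eq_or_ne i k with rfl | hi
    · simp
    · simpa [Function.update_of_ne hi] using hqd i hi
  have hS : (⋃ m ∈ Set.Ici M, {t : K | ¬ ∀ a ∈ 𝒜 m,
      a ∈ Ideal.span (Set.range (p + t • Function.update q k 0))}).Countable :=
    (Set.to_countable _).biUnion fun m hm =>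
      (finite_setOf_not_le_span 𝒜 (hfg m) hp hq' (hM m hm)).countable
  have hT : (⋃ m ∈ Set.Ici N, {t : K | ¬ ∀ a ∈ 𝒜 m,
      a ∈ Ideal.span (Set.range (q + t • Function.update p k 0))}).Countable :=
    (Set.to_countable _).biUnion fun m hm =>
      (finite_setOf_not_le_span 𝒜 (hfg m) hq hp' (hN m hm)).countable
  have hU := (hS.union (hT.preimage inv_injective)).union (Set.countable_singleton 0)
  obtain ⟨t, ht⟩ := (Set.ne_univ_iff_exists_notMem _).1 fun h =>
    Set.not_countable_univ (α := K) (h ▸ hU)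
  simp only [Set.mem_union, Set.mem_iUnion, Set.mem_preimage, Set.mem_singleton_iff,
    Set.mem_ofPred_eq, not_or, not_exists, not_not, Set.mem_Ici] at ht
  obtain ⟨⟨hS, hT⟩, ht0⟩ := ht
  refine ⟨p + t • q, fun i hi => add_mem (hpd i hi) (Submodule.smul_mem _ _ (hqd i hi)),
    fun m hm a ha => ?_, fun m hm a ha => ?_⟩
  · convert hS m hm a ha using 4
    ext i
    rcases eq_or_ne i k with rfl | hi
    · simp
    · simp [Function.update_of_ne hi]
  · refine Ideal.span_le.2 ?_ (hT m hm a ha)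
    rintro _ ⟨i, rfl⟩
    rcases eq_or_ne i k with rfl | hi
    · exact Ideal.subset_span ⟨i, by simp⟩
    · have : (q + t⁻¹ • Function.update p k 0) i =
          algebraMap K A t⁻¹ * Function.update (p + t • q) k (q k) i := by
        simp [Function.update_of_ne hi, ← Algebra.smul_def, smul_smul, ht0, add_comm]
      rw [this]
      exact Ideal.mul_mem_left _ _ (Ideal.subset_span ⟨i, rfl⟩)

end GradedAlgebra

/-- If a domain is algebraic over the subalgebras generated by two families with the same finite
index type, and one family is algebraically independent, then so is the other. -/
theorem algebraicIndependent_of_isAlgebraic_adjoin {K A ι : Type*} [Field K] [CommRing A]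
    [IsDomain A] [Algebra K A] [Finite ι] {x y : ι → A} (hx : AlgebraicIndependent K x)
    (hxA : Algebra.IsAlgebraic (Algebra.adjoin K (Set.range x)) A)
    (hyA : Algebra.IsAlgebraic (Algebra.adjoin K (Set.range y)) A) :
    AlgebraicIndependent K y := by
  have hxb : IsTranscendenceBasis K x := hx.isTranscendenceBasis_iff_isAlgebraic.2 hxA
  obtain ⟨t, hty, htb⟩ := exists_isTranscendenceBasis_subset (R := K) (Set.range y)
  have hcard : Nat.card t = Nat.card ι := by
    have := congrArg Cardinal.toNat (htb.lift_cardinalMk_eq hxb)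
    simpa [Nat.card] using this
  have hle : Nat.card (Set.range y) ≤ Nat.card t := by
    rw [hcard]
    exact Finite.card_range_le y
  have hyt : t = Set.range y := Set.eq_of_subset_of_ncard_le hty hle (Set.finite_range y)
  subst hyt
  have hbij : Function.Bijective (Set.rangeFactorization y) :=
    Set.rangeFactorization_surjective.bijective_of_nat_card_le hcard.ge
  have hinj : Function.Injective y := fun i j hij => hbij.1 (Subtype.ext hij)
  exact ((isTranscendenceBasis_subtype_range hinj).1 htb).1

theorem formPoly_smul (n : ℕ) (c : ℂ) (a : Fin (n+1) → ℂ) :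
    formPoly n (c • a) = C c * formPoly n a := by
  simp [formPoly, Finset.mul_sum, mul_assoc]

theorem sl2Act_smul (n : ℕ) (g : Matrix.SpecialLinearGroup (Fin 2) ℂ) (c : ℂ)
    (a : Fin (n+1) → ℂ) : sl2Act n g (c • a) = c • sl2Act n g a := by
  ext i
  simp only [sl2Act, formPoly_smul, map_mul, bind₁_C_right, coeff_C_mul, Pi.smul_apply,
    smul_eq_mul]

theorem eval_smul_of_isHomogeneous {σ R : Type*} [CommSemiring R] {φ : MvPolynomial σ R} {m : ℕ}
    (hφ : φ.IsHomogeneous m) (c : R) (a : σ → R) : eval (c • a) φ = c ^ m * eval a φ := by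
  rw [eval_eq, eval_eq, Finset.mul_sum]
  refine Finset.sum_congr rfl fun s hs => ?_
  simp only [Pi.smul_apply, smul_eq_mul, mul_pow, Finset.prod_mul_distrib,
    Finset.prod_pow_eq_pow_sum, ← hφ.degree_eq_sum_deg_support hs]
  ring

theorem homogeneousComponent_mem_invariantRing {n : ℕ} {φ : MvPolynomial (Fin (n+1)) ℂ}
    (hφ : φ ∈ invariantRing n) (m : ℕ) : homogeneousComponent m φ ∈ invariantRing n := by
  intro g a
  let P : (Fin (n+1) → ℂ) → Polynomial ℂ := fun b =>
    ∑ j ∈ Finset.range (φ.totalDegree + 1),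
      Polynomial.C (eval b (homogeneousComponent j φ)) * Polynomial.X ^ j
  have hP : ∀ b c, (P b).eval c = eval (c • b) φ := by
    intro b c
    conv_rhs => rw [← sum_homogeneousComponent φ, map_sum]
    simp only [P, Polynomial.eval_finsetSum, Polynomial.eval_mul, Polynomial.eval_C,
      Polynomial.eval_pow, Polynomial.eval_X]
    refine Finset.sum_congr rfl fun j _ => ?_
    rw [eval_smul_of_isHomogeneous (homogeneousComponent_isHomogeneous j φ), mul_comm]
  have hcoeff : ∀ b, (P b).coeff m = eval b (homogeneousComponent m φ) := by
    intro b
    simp only [P, Polynomial.finsetSum_coeff, Polynomial.coeff_C_mul_X_pow,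
      Finset.sum_ite_eq, Finset.mem_range]
    split_ifs with h
    · rfl
    · rw [homogeneousComponent_eq_zero _ _ (by omega), map_zero]
  have hPP : P (sl2Act n g a) = P a := Polynomial.funext fun c => by
    rw [hP, hP, ← sl2Act_smul, hφ g]
  rw [← hcoeff, ← hcoeff, hPP]

/-- The invariants that are homogeneous of degree `m`. -/
def invariantGrading (n m : ℕ) : Submodule ℂ (invariantRing n) :=
  (homogeneousSubmodule (Fin (n+1)) ℂ m).comap (invariantRing n).val.toLinearMap

theorem mem_invariantGrading {n m : ℕ} {φ : invariantRing n} :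
    φ ∈ invariantGrading n m ↔ (φ : MvPolynomial (Fin (n+1)) ℂ).IsHomogeneous m :=
  Iff.rfl

theorem invariantGrading_fg (n m : ℕ) : (invariantGrading n m).FG := by
  refine Submodule.fg_of_fg_map_injective (invariantRing n).val.toLinearMap
    Subtype.val_injective ?_
  exact Submodule.FG.of_le (homogeneousSubmodule_fg _ _ m) (Submodule.map_comap_le _ _)

theorem isInternal_invariantGrading (n : ℕ) : DirectSum.IsInternal (invariantGrading n) := by
  refine DirectSum.isInternal_submodule_of_iSupIndep_of_iSup_eq_top ?_ ?_
  · have h := (letI := gradedAlgebra (σ := Fin (n+1)) (R := ℂ)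
      DirectSum.Decomposition.isInternal
        (homogeneousSubmodule (Fin (n+1)) ℂ)).submodule_iSupIndep
    rw [iSupIndep_iff_finsetSum_eq_zero_imp_eq_zero] at h ⊢
    intro s v hv h0 i hi
    refine Subtype.ext (h s (fun i => v i) hv ?_ i hi)
    simpa using congrArg Subtype.val h0
  · refine top_unique fun φ _ => ?_
    have : φ = ∑ m ∈ Finset.range ((φ : MvPolynomial (Fin (n+1)) ℂ).totalDegree + 1),
        ⟨homogeneousComponent m φ, homogeneousComponent_mem_invariantRing φ.2 m⟩ :=
      Subtype.ext (by simpa using (sum_homogeneousComponent _).symm)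
    rw [this]
    exact Submodule.sum_mem _ fun m _ => Submodule.mem_iSup_of_mem m
      (mem_invariantGrading.2 (homogeneousComponent_isHomogeneous m _))

instance gradedAlgebra_invariantGrading (n : ℕ) : GradedAlgebra (invariantGrading n) where
  one_mem := isHomogeneous_one _ _
  mul_mem _ _ _ _ hφ hψ := IsHomogeneous.mul hφ hψ
  __ := (isInternal_invariantGrading n).chooseDecomposition

theorem stmt_9 (n : ℕ) (hn : 3 ≤ n) (d : Fin (n-2) → ℕ) (k₀ : Fin (n-2)) (d' d'' : ℕ)
    (h1 : ∃ p : Fin (n-2) → invariantRing n, IsHSOP n (Function.update d k₀ d') p)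
    (h2 : ∃ p : Fin (n-2) → invariantRing n, IsHSOP n (Function.update d k₀ d'') p) :
    ∃ p : Fin (n-2) → invariantRing n, IsHSOP n (Function.update d k₀ (d' + d'')) p := by
  obtain ⟨p, hpd, hp, hpi, hpf⟩ := h1
  obtain ⟨q, hqd, hq, -, hqf⟩ := h2
  obtain ⟨M, hM⟩ := exists_le_span_of_finite (invariantGrading n) hp hpf
  obtain ⟨N, hN⟩ := exists_le_span_of_finite (invariantGrading n) hq hqf
  have : Uncountable ℂ := Set.not_countable_univ_iff.1 not_countable_complex
  obtain ⟨f, hf, hfM, hfN⟩ :=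
    exists_common_le_span_update (invariantGrading n) (invariantGrading_fg n) hp hq hM hN
  have hpk : p k₀ ∈ invariantGrading n d' :=
    mem_invariantGrading.2 (by simpa using hp k₀)
  have hqk : q k₀ ∈ invariantGrading n d'' :=
    mem_invariantGrading.2 (by simpa using hq k₀)
  have hupdate : ∀ (u : invariantRing n) (e : ℕ), u ∈ invariantGrading n e →
      ∀ i, Function.update f k₀ u i ∈ invariantGrading n (Function.update d k₀ e i) := by
    intro u e hu i
    rcases eq_or_ne i k₀ with rfl | hi
    · simpa using hu
    · simpa [Function.update_of_ne hi] using hf i hi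
  have hd : ∀ i, 0 < Function.update d k₀ (d' + d'') i := by
    intro i
    have := hpd i
    rcases eq_or_ne i k₀ with rfl | hi
    · simp only [Function.update_self] at this ⊢
      omega
    · simpa only [Function.update_of_ne hi] using this
  have hmem := hupdate (p k₀ * q k₀) (d' + d'') (SetLike.mul_mem_graded hpk hqk)
  have hfin := finite_adjoin_of_le_span (invariantGrading n) (invariantGrading_fg n) hd hmem
    (le_span_mul_update (invariantGrading n) (hupdate _ _ hpk) hfM hfN)
  exact ⟨_, hd, hmem, algebraicIndependent_of_isAlgebraic_adjoin hpi inferInstance inferInstance,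
    hfin⟩
end
end

section
/- A sequence (d_1, d_2) of two positive integers is the degree sequence of a hsop of I_4 (the ring of invariants of the binary quartic) if and only if neither d_1 nor d_2 equals 1, at least one of them is divisible by 2, and at least one of them is divisible by 3. -/
set_option synthInstance.maxHeartbeats 1000000
noncomputable section

open MvPolynomial

lemma coeff_sum_monomials (n : ℕ) (b : Fin (n+1) → ℂ) (i : Fin (n+1)) :
    coeff (Finsupp.single 0 (n - (i : ℕ)) + Finsupp.single 1 (i : ℕ))
      (∑ j : Fin (n+1), C (b j) * (X 0 : MvPolynomial ℕ ℂ) ^ (n - (j : ℕ)) * X 1 ^ (j : ℕ)) =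
      b i := by
  have hm (j : Fin (n+1)) :
      C (b j) * (X 0 : MvPolynomial ℕ ℂ) ^ (n - (j : ℕ)) * X 1 ^ (j : ℕ) =
      monomial (Finsupp.single 0 (n - (j : ℕ)) + Finsupp.single 1 (j : ℕ)) (b j) := by
    rw [mul_assoc, X_pow_eq_monomial, X_pow_eq_monomial, monomial_mul, C_mul_monomial]
    simp
  rw [coeff_sum, Finset.sum_eq_single i]
  · rw [hm, coeff_monomial, if_pos rfl]
  · intro j _ hji
    rw [hm, coeff_monomial, if_neg]
    intro h
    apply hji
    have := DFunLike.congr_fun h 1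
    simpa [Fin.ext_iff] using this
  · simp

lemma sl2Act_eq_of_bind (n : ℕ) (g : Matrix.SpecialLinearGroup (Fin 2) ℂ) (a b : Fin (n+1) → ℂ)
    (h : bind₁ (fun j : Fin 2 => C (g.1 j 0) * X 0 + C (g.1 j 1) * X 1) (formPoly n a) =
      ∑ j : Fin (n+1), C (b j) * (X 0 : MvPolynomial ℕ ℂ) ^ (n - (j : ℕ)) * X 1 ^ (j : ℕ)) :
    sl2Act n g a = b := by
  funext i
  exact (congrArg _ h).trans (coeff_sum_monomials n b i)

lemma sum_monomials_four {σ : Type*} (x y : σ) (a : Fin 5 → ℂ) :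
    ∑ j : Fin (4+1), C (a j) * (X x : MvPolynomial σ ℂ) ^ (4 - (j : ℕ)) * X y ^ (j : ℕ) =
      C (a 0) * X x ^ 4 + C (a 1) * X x ^ 3 * X y + C (a 2) * X x ^ 2 * X y ^ 2
        + C (a 3) * X x * X y ^ 3 + C (a 4) * X y ^ 4 := by
  have h := Fin.sum_univ_five
    fun i : Fin 5 => C (a i) * (X x : MvPolynomial σ ℂ) ^ (4 - (i : ℕ)) * X y ^ (i : ℕ)
  refine h.trans ?_
  simp

/-- The coefficient vector of the quartic with coefficients `a` after the substitution
`x ↦ p x + q y`, `y ↦ r x + s y`. -/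
def substQuartic (p q r s : ℂ) (a : Fin 5 → ℂ) : Fin 5 → ℂ :=
  ![a 0 * p ^ 4 + a 1 * p ^ 3 * r + a 2 * p ^ 2 * r ^ 2 + a 3 * p * r ^ 3 + a 4 * r ^ 4,
    4 * a 0 * p ^ 3 * q + a 1 * (p ^ 3 * s + 3 * p ^ 2 * q * r)
      + a 2 * (2 * p ^ 2 * r * s + 2 * p * q * r ^ 2)
      + a 3 * (3 * p * r ^ 2 * s + q * r ^ 3) + 4 * a 4 * r ^ 3 * s,
    6 * a 0 * p ^ 2 * q ^ 2 + a 1 * (3 * p ^ 2 * q * s + 3 * p * q ^ 2 * r)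
      + a 2 * (p ^ 2 * s ^ 2 + 4 * p * q * r * s + q ^ 2 * r ^ 2)
      + a 3 * (3 * p * r * s ^ 2 + 3 * q * r ^ 2 * s) + 6 * a 4 * r ^ 2 * s ^ 2,
    4 * a 0 * p * q ^ 3 + a 1 * (3 * p * q ^ 2 * s + q ^ 3 * r)
      + a 2 * (2 * p * q * s ^ 2 + 2 * q ^ 2 * r * s)
      + a 3 * (p * s ^ 3 + 3 * q * r * s ^ 2) + 4 * a 4 * r * s ^ 3,
    a 0 * q ^ 4 + a 1 * q ^ 3 * s + a 2 * q ^ 2 * s ^ 2 + a 3 * q * s ^ 3 + a 4 * s ^ 4]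

lemma sl2Act_four (g : Matrix.SpecialLinearGroup (Fin 2) ℂ) (a : Fin 5 → ℂ) (p q r s : ℂ)
    (hp : g.1 0 0 = p) (hq : g.1 0 1 = q) (hr : g.1 1 0 = r) (hs : g.1 1 1 = s) :
    sl2Act 4 g a = substQuartic p q r s a := by
  apply sl2Act_eq_of_bind
  subst hp hq hr hs
  rw [formPoly, sum_monomials_four, substQuartic, sum_monomials_four]
  simp only [map_add, map_mul, map_pow, bind₁_C_right, bind₁_X_right]
  have h4 : (C 4 : MvPolynomial ℕ ℂ) = 4 := map_ofNat C 4
  have h3 : (C 3 : MvPolynomial ℕ ℂ) = 3 := map_ofNat C 3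
  have h2 : (C 2 : MvPolynomial ℕ ℂ) = 2 := map_ofNat C 2
  have h6 : (C 6 : MvPolynomial ℕ ℂ) = 6 := map_ofNat C 6
  simp [h2, h3, h4, h6]
  ring

/-- The quadratic invariant of the binary quartic. -/
def quarticI : MvPolynomial (Fin 5) ℂ := 12 * X 0 * X 4 - 3 * X 1 * X 3 + X 2 ^ 2

/-- The cubic invariant of the binary quartic. -/
def quarticJ : MvPolynomial (Fin 5) ℂ :=
  72 * X 0 * X 2 * X 4 + 9 * X 1 * X 2 * X 3 - 27 * X 0 * X 3 ^ 2 - 27 * X 1 ^ 2 * X 4 - 2 * X 2 ^ 3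

lemma eval_quarticI (a : Fin 5 → ℂ) :
    eval a quarticI = 12 * a 0 * a 4 - 3 * a 1 * a 3 + a 2 ^ 2 := by
  simp [quarticI]

lemma eval_quarticJ (a : Fin 5 → ℂ) :
    eval a quarticJ = 72 * a 0 * a 2 * a 4 + 9 * a 1 * a 2 * a 3 - 27 * a 0 * a 3 ^ 2
      - 27 * a 1 ^ 2 * a 4 - 2 * a 2 ^ 3 := by
  simp [quarticJ]

lemma det_entries (g : Matrix.SpecialLinearGroup (Fin 2) ℂ) :
    g.1 0 0 * g.1 1 1 - g.1 0 1 * g.1 1 0 = 1 := by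
  rw [← Matrix.det_fin_two, g.2]

lemma quarticI_mem : quarticI ∈ invariantRing 4 := by
  intro g a
  rw [eval_quarticI, eval_quarticI, sl2Act_four g a _ _ _ _ rfl rfl rfl rfl, substQuartic]
  have h := det_entries g
  generalize g.1 0 0 = p, g.1 0 1 = q, g.1 1 0 = r, g.1 1 1 = s at *
  have h4 : (p * s - q * r) ^ 4 = 1 := by rw [h, one_pow]
  simp
  linear_combination (12 * a 0 * a 4 - 3 * a 1 * a 3 + a 2 ^ 2) * h4

lemma quarticJ_mem : quarticJ ∈ invariantRing 4 := by
  intro g a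
  rw [eval_quarticJ, eval_quarticJ, sl2Act_four g a _ _ _ _ rfl rfl rfl rfl, substQuartic]
  have h := det_entries g
  generalize g.1 0 0 = p, g.1 0 1 = q, g.1 1 0 = r, g.1 1 1 = s at *
  have h6 : (p * s - q * r) ^ 6 = 1 := by rw [h, one_pow]
  simp
  linear_combination (72 * a 0 * a 2 * a 4 + 9 * a 1 * a 2 * a 3 - 27 * a 0 * a 3 ^ 2
      - 27 * a 1 ^ 2 * a 4 - 2 * a 2 ^ 3) * h6

lemma eval_subst_of_mem {u : MvPolynomial (Fin 5) ℂ} (hu : u ∈ invariantRing 4) (p q r s : ℂ)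
    (h : p * s - q * r = 1) (a : Fin 5 → ℂ) :
    eval (substQuartic p q r s a) u = eval a u := by
  obtain ⟨g, hp, hq, hr, hs⟩ : ∃ g : Matrix.SpecialLinearGroup (Fin 2) ℂ,
      g.1 0 0 = p ∧ g.1 0 1 = q ∧ g.1 1 0 = r ∧ g.1 1 1 = s :=
    ⟨⟨!![p, q; r, s], by rw [Matrix.det_fin_two_of, h]⟩, rfl, rfl, rfl, rfl⟩
  rw [← sl2Act_four g a p q r s hp hq hr hs, hu g a]

lemma eval_eq_zero_of_slice {u : MvPolynomial (Fin 5) ℂ} (hu : u ∈ invariantRing 4)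
    (h0 : ∀ b c, eval ![0, 1, 0, b, c] u = 0) {a : Fin 5 → ℂ} (ha0 : a 0 = 0) (ha1 : a 1 ≠ 0) :
    eval a u = 0 := by
  obtain ⟨t, ht⟩ := IsAlgClosed.exists_pow_nat_eq (a 1)⁻¹ (n := 2) two_pos
  have ht0 : t ≠ 0 := by
    rintro rfl
    exact inv_ne_zero ha1 (by rw [← ht]; simp)
  have ht1 : a 1 * t ^ 2 = 1 := by rw [ht]; exact mul_inv_cancel₀ ha1
  rw [← eval_subst_of_mem hu t (-a 2 / (3 * a 1 * t)) 0 t⁻¹ (by simp [ht0]) a]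
  set b := substQuartic t (-a 2 / (3 * a 1 * t)) 0 t⁻¹ a with hb
  have hb' : b = ![0, 1, 0, b 3, b 4] := by
    ext i
    fin_cases i
    · simp [hb, substQuartic, ha0]
    · simp only [hb, substQuartic, ha0, Fin.mk_one, Matrix.cons_val]
      field_simp
      linear_combination 3 * t * a 1 * ht1
    · simp only [hb, substQuartic, ha0, Fin.reduceFinMk, Matrix.cons_val]
      field_simp
      ring
    · rfl
    · rfl
  rw [hb']
  exact h0 _ _

lemma eval_eq_zero_of_simple_root {u : MvPolynomial (Fin 5) ℂ} (hu : u ∈ invariantRing 4)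
    (h0 : ∀ b c, eval ![0, 1, 0, b, c] u = 0) {a : Fin 5 → ℂ} {z : ℂ}
    (hz : a 0 * z ^ 4 + a 1 * z ^ 3 + a 2 * z ^ 2 + a 3 * z + a 4 = 0)
    (hz' : 4 * a 0 * z ^ 3 + 3 * a 1 * z ^ 2 + 2 * a 2 * z + a 3 ≠ 0) :
    eval a u = 0 := by
  rw [← eval_subst_of_mem hu z (-1) 1 0 (by ring) a]
  apply eval_eq_zero_of_slice hu h0
  · simp only [substQuartic, Matrix.cons_val]
    linear_combination hz
  · simp only [substQuartic, Matrix.cons_val]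
    contrapose! hz'
    linear_combination -hz'

lemma eval_eq_zero_of_leading_ne_zero {u : MvPolynomial (Fin 5) ℂ} (hu : u ∈ invariantRing 4)
    (h0 : ∀ b c, eval ![0, 1, 0, b, c] u = 0) {a : Fin 5 → ℂ} (ha : a 0 ≠ 0) :
    eval a u = 0 := by
  let F : Polynomial ℂ := Polynomial.C (a 0) * Polynomial.X ^ 4 + Polynomial.C (a 1) *
    Polynomial.X ^ 3 + Polynomial.C (a 2) * Polynomial.X ^ 2 + Polynomial.C (a 3) * Polynomial.X
    + Polynomial.C (a 4)
  have hFdeg (t : ℂ) : (F + Polynomial.C t).natDegree = 4 := by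
    simp only [F]
    compute_degree!
  have hF' : F.derivative ≠ 0 := by
    intro h
    have h1 := Polynomial.derivative_eq_zero.mp h
    have h2 := hFdeg 0
    simp only [map_zero, add_zero] at h2
    omega
  let T : Set ℂ := (fun z => -F.eval z) '' {z | F.derivative.IsRoot z}
  have hT : T.Finite := (Polynomial.finite_setOfPred_isRoot hF').image _
  have hvan (t : ℂ) (ht : t ∉ T) : eval ![a 0, a 1, a 2, a 3, a 4 + t] u = 0 := by
    obtain ⟨z, hz⟩ := IsAlgClosed.exists_root (F + Polynomial.C t) (by
      rw [Polynomial.degree_eq_natDegree (by intro h; simpa [h] using hFdeg t), hFdeg]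
      norm_num)
    have hz' : ¬ F.derivative.IsRoot z := by
      intro hc
      refine ht ⟨z, hc, ?_⟩
      simp only [Polynomial.IsRoot, Polynomial.eval_add, Polynomial.eval_C] at hz
      linear_combination -hz
    apply eval_eq_zero_of_simple_root hu h0 (z := z)
    · simp only [Polynomial.IsRoot, F, Polynomial.eval_add, Polynomial.eval_mul, Polynomial.eval_C,
        Polynomial.eval_pow, Polynomial.eval_X] at hz
      simp only [Matrix.cons_val]
      linear_combination hz
    · intro hc
      apply hz'
      simp [Polynomial.IsRoot, F]
      simp only [Matrix.cons_val] at hc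
      linear_combination hc
  let P : Polynomial ℂ := aeval ![Polynomial.C (a 0), Polynomial.C (a 1), Polynomial.C (a 2),
    Polynomial.C (a 3), Polynomial.C (a 4) + Polynomial.X] u
  have hP (t : ℂ) : P.eval t = eval ![a 0, a 1, a 2, a 3, a 4 + t] u := by
    rw [← Polynomial.coe_aeval_eq_eval, ← MvPolynomial.coe_aeval_eq_eval]
    simp only [P]
    rw [← AlgHom.comp_apply]
    change _ = aeval ![a 0, a 1, a 2, a 3, a 4 + t] u
    congr 1
    ext i
    fin_cases i <;> simp
  have hP0 : P = 0 := by
    apply Polynomial.eq_zero_of_infinite_isRoot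
    refine hT.infinite_compl.mono fun t ht => ?_
    exact (hP t).trans (hvan t ht)
  have h := hP 0
  rw [hP0, Polynomial.eval_zero, add_zero] at h
  rw [h]
  congr 2
  ext i
  fin_cases i <;> rfl

lemma eq_zero_of_slice {u : MvPolynomial (Fin 5) ℂ} (hu : u ∈ invariantRing 4)
    (h0 : ∀ b c, eval ![0, 1, 0, b, c] u = 0) : u = 0 := by
  have h : X 0 * u = 0 := by
    apply MvPolynomial.funext
    intro a
    rw [map_mul, eval_X, map_zero]
    by_cases ha : a 0 = 0
    · rw [ha, zero_mul]
    · rw [eval_eq_zero_of_leading_ne_zero hu h0 ha, mul_zero]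
  exact (mul_eq_zero.mp h).resolve_left (X_ne_zero 0)

/-- Restriction of invariants to the quartics `x³y - (b/3) xy³ - (c/27) y⁴`. -/
def sliceHom : invariantRing 4 →ₐ[ℂ] MvPolynomial (Fin 2) ℂ :=
  (aeval (R := ℂ)
    (![0, 1, 0, C (-1 / 3) * X 0, C (-1 / 27) * X 1] : Fin 5 → MvPolynomial (Fin 2) ℂ)).comp
    (invariantRing 4).val

lemma eval_sliceHom (u : invariantRing 4) (v : Fin 2 → ℂ) :
    eval v (sliceHom u) = eval ![0, 1, 0, -1 / 3 * v 0, -1 / 27 * v 1] u.1 := by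
  have : (aeval v).comp (aeval (R := ℂ)
        (![0, 1, 0, C (-1 / 3) * X 0, C (-1 / 27) * X 1] : Fin 5 → MvPolynomial (Fin 2) ℂ))
      = aeval (R := ℂ) ![0, 1, 0, -1 / 3 * v 0, -1 / 27 * v 1] := by
    ext i
    fin_cases i <;> simp
  exact DFunLike.congr_fun this u.1

lemma sliceHom_injective : Function.Injective sliceHom := by
  rw [injective_iff_map_eq_zero]
  intro u hu
  apply Subtype.ext
  apply eq_zero_of_slice u.2
  intro b c
  have h := eval_sliceHom u ![-3 * b, -27 * c]
  rw [hu, map_zero] at h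
  convert h.symm using 3
  simp [← mul_assoc]

/-- The two basic invariants of the binary quartic, as elements of the invariant ring. -/
def basicInvariants : Fin 2 → invariantRing 4 :=
  ![⟨quarticI, quarticI_mem⟩, ⟨quarticJ, quarticJ_mem⟩]

lemma sliceHom_comp_aeval :
    sliceHom.comp (aeval basicInvariants) = AlgHom.id ℂ (MvPolynomial (Fin 2) ℂ) := by
  ext1 i
  apply MvPolynomial.funext
  intro v
  simp only [AlgHom.comp_apply, aeval_X, AlgHom.id_apply, eval_sliceHom]
  fin_cases i
  · refine (eval_quarticI _).trans ?_
    simp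
    ring
  · refine (eval_quarticJ _).trans ?_
    simp
    ring

lemma basicInvariants_algebraicIndependent : AlgebraicIndependent ℂ basicInvariants :=
  Function.LeftInverse.injective (g := sliceHom) (DFunLike.congr_fun sliceHom_comp_aeval)

lemma adjoin_basicInvariants : Algebra.adjoin ℂ (Set.range basicInvariants) = ⊤ := by
  rw [Algebra.adjoin_range_eq_range_aeval, AlgHom.range_eq_top]
  intro u
  exact ⟨sliceHom u, sliceHom_injective (DFunLike.congr_fun sliceHom_comp_aeval (sliceHom u))⟩

lemma aeval_line {σ : Type*} {u : MvPolynomial σ ℂ} {d : ℕ} (hu : u.IsHomogeneous d) (a : σ → ℂ) :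
    aeval (fun i => Polynomial.C (a i) * Polynomial.X) u =
      Polynomial.C (eval a u) * Polynomial.X ^ d := by
  rw [aeval_def, eval₂_eq, eval_eq, map_sum, Finset.sum_mul]
  refine Finset.sum_congr rfl fun m hm => ?_
  simp only [mul_pow, Finset.prod_mul_distrib, map_mul, map_prod, map_pow, mul_assoc]
  congr 2
  rw [Finset.prod_pow_eq_pow_sum, ← hu.degree_eq_sum_deg_support hm]

lemma eval_smul_of_isHomogeneous_s11 {σ : Type*} {u : MvPolynomial σ ℂ} {d : ℕ}
    (hu : u.IsHomogeneous d) (c : ℂ) (a : σ → ℂ) : eval (c • a) u = c ^ d * eval a u := by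
  rw [eval_eq, eval_eq, Finset.mul_sum]
  refine Finset.sum_congr rfl fun m hm => ?_
  simp only [Pi.smul_apply, smul_eq_mul, mul_pow, Finset.prod_mul_distrib]
  rw [Finset.prod_pow_eq_pow_sum, ← hu.degree_eq_sum_deg_support hm]
  ring

lemma eval_eq_zero_of_subst_eq_smul {u : MvPolynomial (Fin 5) ℂ} (hu : u ∈ invariantRing 4)
    {d : ℕ} (hd : u.IsHomogeneous d) {t c : ℂ} (ht : t ≠ 0) {a : Fin 5 → ℂ}
    (ha : substQuartic t 0 0 t⁻¹ a = c • a) (hc : c ^ d ≠ 1) : eval a u = 0 := by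
  have h := eval_subst_of_mem hu t 0 0 t⁻¹ (by simp [ht]) a
  rw [ha, eval_smul_of_isHomogeneous_s11 hd] at h
  have h2 : (c ^ d - 1) * eval a u = 0 := by linear_combination h
  exact (mul_eq_zero.mp h2).resolve_left (sub_ne_zero.mpr hc)

lemma eval_eq_zero_of_not_two_dvd {u : MvPolynomial (Fin 5) ℂ} (hu : u ∈ invariantRing 4)
    {d : ℕ} (hd : u.IsHomogeneous d) (h2 : ¬ 2 ∣ d) : eval ![1, 0, 0, 0, 1] u = 0 := by
  obtain ⟨t, ht⟩ := IsAlgClosed.exists_pow_nat_eq (-1 : ℂ) (n := 4) (by norm_num)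
  have ht0 : t ≠ 0 := by
    rintro rfl
    norm_num at ht
  refine eval_eq_zero_of_subst_eq_smul hu hd (t := t) (c := -1) ht0 ?_ ?_
  · ext i
    fin_cases i <;> simp [substQuartic, ht]
  · rw [Odd.neg_one_pow (by rwa [← Nat.not_even_iff_odd, even_iff_two_dvd])]
    norm_num

lemma eval_eq_zero_of_not_three_dvd {u : MvPolynomial (Fin 5) ℂ} (hu : u ∈ invariantRing 4)
    {d : ℕ} (hd : u.IsHomogeneous d) (h3 : ¬ 3 ∣ d) : eval ![1, 0, 0, 1, 0] u = 0 := by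
  have hw : IsPrimitiveRoot (Complex.exp (2 * Real.pi * Complex.I / (3 : ℕ))) 3 :=
    Complex.isPrimitiveRoot_exp 3 (by norm_num)
  generalize Complex.exp (2 * Real.pi * Complex.I / (3 : ℕ)) = w at hw
  have hw3 : w ^ 3 = 1 := hw.pow_eq_one
  have hw0 : w ≠ 0 := hw.ne_zero (by norm_num)
  refine eval_eq_zero_of_subst_eq_smul hu hd (t := w) (c := w) hw0 ?_ ?_
  · ext i
    fin_cases i
    · simp [substQuartic]
      linear_combination w * hw3
    · simp [substQuartic]
    · simp [substQuartic]
    · simp [substQuartic]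
      field_simp
      linear_combination -hw3
    · simp [substQuartic]
  · rwa [Ne, hw.pow_eq_one_iff_dvd]

lemma eq_zero_of_isHomogeneous_one {u : MvPolynomial (Fin 5) ℂ} (hu : u ∈ invariantRing 4)
    (hd : u.IsHomogeneous 1) : u = 0 := by
  obtain ⟨c, hc⟩ : ∃ c : Fin 5 → ℂ, u = ∑ i, c i • X i := by
    have : u ∈ Submodule.span ℂ (Set.range (X : Fin 5 → MvPolynomial (Fin 5) ℂ)) := by
      rw [← homogeneousSubmodule_one_eq_span_X]
      exact hd
    obtain ⟨c, hc⟩ := (Submodule.mem_span_range_iff_exists_fun ℂ).mp this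
    exact ⟨c, hc.symm⟩
  have hev (a : Fin 5 → ℂ) :
      eval a u = c 0 * a 0 + c 1 * a 1 + c 2 * a 2 + c 3 * a 3 + c 4 * a 4 := by
    rw [hc, Fin.sum_univ_five]
    simp [smul_eval]
  have h1 : c 1 = 0 := by
    have := eval_eq_zero_of_subst_eq_smul hu hd (t := 2) (c := 4) (a := ![0, 1, 0, 0, 0])
      (by norm_num) (by ext i; fin_cases i <;> simp [substQuartic]; norm_num) (by norm_num)
    simpa [hev] using this
  have h3 : c 3 = 0 := by
    have := eval_eq_zero_of_subst_eq_smul hu hd (t := 2) (c := 1 / 4) (a := ![0, 0, 0, 1, 0])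
      (by norm_num) (by ext i; fin_cases i <;> simp [substQuartic]; norm_num) (by norm_num)
    simpa [hev] using this
  have h4 : c 4 = 0 := by
    have := eval_eq_zero_of_subst_eq_smul hu hd (t := 2) (c := 1 / 16) (a := ![0, 0, 0, 0, 1])
      (by norm_num) (by ext i; fin_cases i <;> simp [substQuartic]; norm_num) (by norm_num)
    simpa [hev] using this
  refine eq_zero_of_slice hu fun b e => ?_
  simp [hev, h1, h3, h4]

lemma eval_eq_zero_of_finite {n : ℕ} {ι : Type*} {d : ι → ℕ} {p : ι → invariantRing n}
    (hp : ∀ k, (p k : MvPolynomial (Fin (n+1)) ℂ).IsHomogeneous (d k))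
    (hfin : Module.Finite (Algebra.adjoin ℂ (Set.range p)) (invariantRing n))
    {a : Fin (n+1) → ℂ} (ha : ∀ k, eval a (p k : MvPolynomial (Fin (n+1)) ℂ) = 0)
    (u : invariantRing n) {m : ℕ} (hm : 0 < m)
    (hu : (u : MvPolynomial (Fin (n+1)) ℂ).IsHomogeneous m) :
    eval a (u : MvPolynomial (Fin (n+1)) ℂ) = 0 := by
  let ψ : invariantRing n →ₐ[ℂ] Polynomial ℂ :=
    (aeval fun i => Polynomial.C (a i) * Polynomial.X).comp (invariantRing n).val
  have hψ (v : invariantRing n) {e : ℕ} (hv : (v : MvPolynomial (Fin (n+1)) ℂ).IsHomogeneous e) :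
      ψ v = Polynomial.C (eval a (v : MvPolynomial (Fin (n+1)) ℂ)) * Polynomial.X ^ e :=
    aeval_line hv a
  have hconst : ∀ s ∈ Algebra.adjoin ℂ (Set.range p), ψ s ∈ (⊥ : Subalgebra ℂ (Polynomial ℂ)) := by
    intro s hs
    have : Algebra.adjoin ℂ (Set.range p) ≤ (⊥ : Subalgebra ℂ (Polynomial ℂ)).comap ψ := by
      rw [Algebra.adjoin_le_iff]
      rintro _ ⟨k, rfl⟩
      simp [hψ (p k) (hp k), ha]
    exact this hs
  have hintegral : IsIntegral (Algebra.adjoin ℂ (Set.range p)) u := Algebra.IsIntegral.isIntegral u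
  obtain ⟨P, hP, hP0⟩ := hintegral
  have hintegral2 : IsIntegral (⊥ : Subalgebra ℂ (Polynomial ℂ)) (ψ u) := by
    let φ : Algebra.adjoin ℂ (Set.range p) →+* (⊥ : Subalgebra ℂ (Polynomial ℂ)) :=
      ((ψ.comp (Algebra.adjoin ℂ (Set.range p)).val).codRestrict ⊥ fun s => hconst s s.2).toRingHom
    refine ⟨P.map φ, hP.map φ, ?_⟩
    rw [Polynomial.eval₂_map]
    have h := congrArg ψ.toRingHom hP0
    rw [Polynomial.hom_eval₂, map_zero] at h
    exact h
  have hintegral3 : IsIntegral ℂ (ψ u) := by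
    have : Algebra.IsIntegral ℂ (⊥ : Subalgebra ℂ (Polynomial ℂ)) := inferInstance
    exact isIntegral_trans _ hintegral2
  by_contra hne
  refine Polynomial.transcendental (ψ u) ?_ ?_ hintegral3.isAlgebraic
  · rw [hψ u hu, Polynomial.natDegree_C_mul_X_pow _ _ hne]
    exact hm.ne'
  · rw [hψ u hu, Polynomial.leadingCoeff_C_mul_X_pow]
    exact mem_nonZeroDivisors_of_ne_zero hne

lemma isHSOP_of_isIntegral {d : Fin 2 → ℕ} (hpos : ∀ k, 0 < d k) (p : Fin 2 → invariantRing 4)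
    (hp : ∀ k, (p k : MvPolynomial (Fin 5) ℂ).IsHomogeneous (d k))
    (hintegral : ∀ k, IsIntegral (Algebra.adjoin ℂ (Set.range p)) (basicInvariants k)) :
    IsHSOP 4 d p := by
  have hI : Algebra.IsIntegral (Algebra.adjoin ℂ (Set.range p)) (invariantRing 4) := by
    constructor
    intro u
    have : Algebra.adjoin ℂ (Set.range basicInvariants) ≤
        (integralClosure (Algebra.adjoin ℂ (Set.range p)) (invariantRing 4)).restrictScalars ℂ := by
      rw [Algebra.adjoin_le_iff]
      rintro _ ⟨k, rfl⟩
      exact hintegral k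
    rw [adjoin_basicInvariants] at this
    exact this (Algebra.mem_top (x := u))
  have hft : Algebra.FiniteType ℂ (invariantRing 4) :=
    ⟨⟨(Set.finite_range basicInvariants).toFinset, by
      rw [Set.Finite.coe_toFinset, adjoin_basicInvariants]⟩⟩
  refine ⟨hpos, hp, ?_, ?_⟩
  · exact (Algebra.IsAlgebraic.isTranscendenceBasis_of_le_trdeg_of_finite (R := ℂ) p
      basicInvariants_algebraicIndependent.cardinalMk_le_trdeg).1
  · have : Algebra.FiniteType (Algebra.adjoin ℂ (Set.range p)) (invariantRing 4) :=
      Algebra.FiniteType.of_restrictScalars_finiteType ℂ _ _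
    exact Algebra.IsIntegral.finite (R := Algebra.adjoin ℂ (Set.range p)) (A := invariantRing 4)

lemma exists_isHSOP_of_pair {d : Fin 2 → ℕ} (hpos : ∀ k, 0 < d k) {i j : Fin 2} (hij : i ≠ j)
    (u v : invariantRing 4) (hu : (u : MvPolynomial (Fin 5) ℂ).IsHomogeneous (d i))
    (hv : (v : MvPolynomial (Fin 5) ℂ).IsHomogeneous (d j))
    (hintegral : ∀ S : Subalgebra ℂ (invariantRing 4), u ∈ S → v ∈ S →
      ∀ k, IsIntegral S (basicInvariants k)) :
    ∃ p : Fin (4-2) → invariantRing 4, IsHSOP 4 d p := by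
  let p : Fin 2 → invariantRing 4 := fun k => if k = i then u else v
  have hpi : p i = u := if_pos rfl
  have hpj : p j = v := if_neg hij.symm
  refine ⟨p, isHSOP_of_isIntegral hpos p (fun k => ?_) (hintegral _ ?_ ?_)⟩
  · by_cases hk : k = i
    · rw [hk, hpi]
      exact hu
    · have hkj : k = j := by omega
      rw [hkj, hpj]
      exact hv
  · exact Algebra.subset_adjoin ⟨i, hpi⟩
  · exact Algebra.subset_adjoin ⟨j, hpj⟩

lemma isHomogeneous_quarticI : quarticI.IsHomogeneous 2 := by
  have h12 : (12 : MvPolynomial (Fin 5) ℂ) = C 12 := (map_ofNat C 12).symm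
  have h3 : (3 : MvPolynomial (Fin 5) ℂ) = C 3 := (map_ofNat C 3).symm
  rw [quarticI, h12, h3]
  exact ((((isHomogeneous_X ℂ 0).C_mul 12).mul (isHomogeneous_X ℂ 4)).sub
    (((isHomogeneous_X ℂ 1).C_mul 3).mul (isHomogeneous_X ℂ 3))).add ((isHomogeneous_X ℂ 2).pow 2)

lemma isHomogeneous_quarticJ : quarticJ.IsHomogeneous 3 := by
  have h72 : (72 : MvPolynomial (Fin 5) ℂ) = C 72 := (map_ofNat C 72).symm
  have h9 : (9 : MvPolynomial (Fin 5) ℂ) = C 9 := (map_ofNat C 9).symm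
  have h27 : (27 : MvPolynomial (Fin 5) ℂ) = C 27 := (map_ofNat C 27).symm
  have h2 : (2 : MvPolynomial (Fin 5) ℂ) = C 2 := (map_ofNat C 2).symm
  rw [quarticJ, h72, h9, h27, h2]
  have hX := isHomogeneous_X (σ := Fin 5) ℂ
  exact (((((((hX 0).C_mul 72).mul (hX 2)).mul (hX 4)).add
    ((((hX 1).C_mul 9).mul (hX 2)).mul (hX 3))).sub
    (((hX 0).C_mul 27).mul ((hX 3).pow 2))).sub
    ((((hX 1).pow 2).C_mul 27).mul (hX 4))).sub (((hX 2).pow 3).C_mul 2)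

lemma isIntegral_of_cube_add_square {R A : Type*} [CommRing R] [CommRing A] [Algebra R A]
    {x y : A} {a b : ℕ} (hab : 0 < a + b) (hU : IsIntegral R (x ^ 3 + y ^ 2))
    (hW : IsIntegral R (x ^ a * y ^ b)) : IsIntegral R x := by
  nontriviality A
  let T := integralClosure R A
  refine isIntegral_trans (A := T) x ?_
  let U : T := ⟨_, hU⟩
  let W : T := ⟨_, hW⟩
  let Q : Polynomial T := Polynomial.X ^ (2 * a) * (Polynomial.X ^ 3 - Polynomial.C U) ^ b
  have h3 : (Polynomial.X ^ 3 - Polynomial.C U).Monic := Polynomial.monic_X_pow_sub_C U (by norm_num)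
  have hQ : Q.Monic := (Polynomial.monic_X_pow _).mul (h3.pow b)
  have hdeg : Q.natDegree = 2 * a + b * 3 := by
    rw [(Polynomial.monic_X_pow _).natDegree_mul (h3.pow b), h3.natDegree_pow,
      Polynomial.natDegree_X_pow, Polynomial.natDegree_X_pow_sub_C]
  refine ⟨Q - Polynomial.C ((-1) ^ b * W ^ 2), hQ.sub_of_left ?_, ?_⟩
  · refine Polynomial.degree_C_le.trans_lt ?_
    rw [← Polynomial.natDegree_pos_iff_degree_pos, hdeg]
    omega
  · simp only [Q, Polynomial.eval₂_sub, Polynomial.eval₂_mul, Polynomial.eval₂_pow,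
      Polynomial.eval₂_X, Polynomial.eval₂_C, Polynomial.eval₂_neg,
      Polynomial.eval₂_one, map_mul, map_pow, map_neg, map_one]
    change x ^ (2 * a) * (x ^ 3 - (x ^ 3 + y ^ 2)) ^ b - (-1) ^ b * (x ^ a * y ^ b) ^ 2 = 0
    rw [sub_add_cancel_left, neg_pow]
    ring

lemma exists_isHSOP_of_two_dvd_of_three_dvd {d : Fin 2 → ℕ} (hpos : ∀ k, 0 < d k) {i j : Fin 2}
    (hij : i ≠ j) (hi : 2 ∣ d i) (hj : 3 ∣ d j) :
    ∃ p : Fin (4-2) → invariantRing 4, IsHSOP 4 d p := by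
  obtain ⟨a, ha⟩ := hi
  obtain ⟨b, hb⟩ := hj
  have hi0 := hpos i
  have hj0 := hpos j
  refine exists_isHSOP_of_pair hpos hij (basicInvariants 0 ^ a) (basicInvariants 1 ^ b)
    (by rw [ha]; exact isHomogeneous_quarticI.pow a)
    (by rw [hb]; exact isHomogeneous_quarticJ.pow b) fun S hu hv => ?_
  rw [Fin.forall_fin_two]
  exact ⟨IsIntegral.of_pow (n := a) (by omega) (isIntegral_algebraMap (x := (⟨_, hu⟩ : S))),
    IsIntegral.of_pow (n := b) (by omega) (isIntegral_algebraMap (x := (⟨_, hv⟩ : S)))⟩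

lemma exists_isHSOP_of_six_dvd {d : Fin 2 → ℕ} (hpos : ∀ k, 0 < d k) {i j : Fin 2}
    (hij : i ≠ j) (hi : 6 ∣ d i) (hj : d j ≠ 1) :
    ∃ p : Fin (4-2) → invariantRing 4, IsHSOP 4 d p := by
  obtain ⟨k, hk⟩ := hi
  have hi0 := hpos i
  have hj0 := hpos j
  obtain ⟨a, b, hab⟩ : ∃ a b, d j = 2 * a + 3 * b := by
    rcases Nat.even_or_odd' (d j) with ⟨c, hc | hc⟩
    · exact ⟨c, 0, by omega⟩
    · exact ⟨c - 1, 1, by omega⟩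
  refine exists_isHSOP_of_pair hpos hij ((basicInvariants 0 ^ 3 + basicInvariants 1 ^ 2) ^ k)
    (basicInvariants 0 ^ a * basicInvariants 1 ^ b) ?_ ?_ fun S hu hv => ?_
  · rw [hk]
    exact ((isHomogeneous_quarticI.pow 3).add (isHomogeneous_quarticJ.pow 2)).pow k
  · rw [hab]
    exact (isHomogeneous_quarticI.pow a).mul (isHomogeneous_quarticJ.pow b)
  have hU : IsIntegral S (basicInvariants 0 ^ 3 + basicInvariants 1 ^ 2) :=
    IsIntegral.of_pow (n := k) (by omega) (isIntegral_algebraMap (x := (⟨_, hu⟩ : S)))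
  have hW : IsIntegral S (basicInvariants 0 ^ a * basicInvariants 1 ^ b) :=
    isIntegral_algebraMap (x := (⟨_, hv⟩ : S))
  have hI : IsIntegral S (basicInvariants 0) :=
    isIntegral_of_cube_add_square (by omega) hU hW
  have hJ : IsIntegral S (basicInvariants 1) := by
    refine IsIntegral.of_pow (n := 2) two_pos ?_
    have := hU.sub (hI.pow 3)
    rwa [add_sub_cancel_left] at this
  rw [Fin.forall_fin_two]
  exact ⟨hI, hJ⟩

theorem stmt_11 (d : Fin 2 → ℕ) (hd : ∀ k, 0 < d k) :
    (∃ p : Fin (4-2) → invariantRing 4, IsHSOP 4 d p) ↔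
      ((∀ k, d k ≠ 1) ∧ (∃ k, 2 ∣ d k) ∧ (∃ k, 3 ∣ d k)) := by
  constructor
  · rintro ⟨p, -, hp, hind, hfin⟩
    refine ⟨fun k hk => ?_, ?_, ?_⟩
    · have h1 := hp k
      rw [hk] at h1
      exact hind.ne_zero k (Subtype.ext (eq_zero_of_isHomogeneous_one (p k).2 h1))
    · by_contra! h
      have := eval_eq_zero_of_finite hp hfin
        (fun k => eval_eq_zero_of_not_two_dvd (p k).2 (hp k) (h k))
        ⟨quarticI, quarticI_mem⟩ two_pos isHomogeneous_quarticI
      simp [eval_quarticI] at this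
    · by_contra! h
      have := eval_eq_zero_of_finite hp hfin
        (fun k => eval_eq_zero_of_not_three_dvd (p k).2 (hp k) (h k))
        ⟨quarticJ, quarticJ_mem⟩ three_pos isHomogeneous_quarticJ
      simp [eval_quarticJ] at this
  · rintro ⟨h1, ⟨i, hi⟩, j, hj⟩
    by_cases hij : i = j
    · subst hij
      exact exists_isHSOP_of_six_dvd hd (i := i) (j := i + 1) (by omega) (by omega) (h1 _)
    · exact exists_isHSOP_of_two_dvd_of_three_dvd hd hij hi hj
end
end
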